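/- arXiv:1202.2235 — 13 statements merged into one kernel-verified Lean document; each statement's English description precedes it below -/
import Mathlib

section
/- Let Ω ⊆ ℝ² be open, V, W : Ω → ℝ² be C^∞ vector fields that are linearly independent at every point of Ω, and let μ : Ω → ℝ be C^∞ with [V,W] = μ·V on Ω. Let φ_V : ℝ × Ω → Ω be a C^∞ flow of V, let z : ℝ → Ω be a C^∞ solution of z'(s) = W(z(s)), and let T : ℝ → ℝ be a C^∞ function with T(s) > 0 and φ_V(T(s), z(s)) = z(s) for all s (so z(s) lies on a periodic orbit of V of period T(s)). Then for every s, T'(s) = ∫₀^{T(s)} μ(φ_V(t, z(s))) dt. -/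
open Set in
/-- A solution of a linear differential equation `u' = A(t) u` that vanishes at `a`
vanishes at all later times. -/
theorem eq_zero_of_hasDerivAt_linear {E : Type*} [NormedAddCommGroup E] [NormedSpace ℝ E]
    {A : ℝ → E →L[ℝ] E} (hA : Continuous A) {u : ℝ → E}
    (hu : ∀ t, HasDerivAt u (A t (u t)) t) {a b : ℝ} (hab : a ≤ b) (ha : u a = 0) :
    u b = 0 := by
  obtain ⟨K, hK⟩ := isCompact_Icc.exists_bound_of_continuousOn (s := Icc a b) hA.continuousOn
  refine eq_zero_of_abs_deriv_le_mul_abs_self_of_eq_zero_right (f' := fun t => A t (u t)) (K := K)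
    (fun t _ => (hu t).continuousAt.continuousWithinAt)
    (fun t _ => (hu t).hasDerivWithinAt) ha (fun t ht => ?_) b ⟨hab, le_rfl⟩
  exact (A t).le_of_opNorm_le (hK t ⟨ht.1, ht.2.le⟩) (u t)

/-- The variational equation: if `∂ₜ g = V ∘ g`, then `∂ₛ g` solves the linearization of `V`
along `g`. -/
theorem hasDerivAt_fderiv_of_fderiv_eq_comp {E : Type*} [NormedAddCommGroup E] [NormedSpace ℝ E]
    {g : ℝ × ℝ → E} (hg : ContDiff ℝ 2 g) {V : E → E}
    (hgV : ∀ p, fderiv ℝ g p (1, 0) = V (g p)) (t s : ℝ)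
    (hV : DifferentiableAt ℝ V (g (t, s))) :
    HasDerivAt (fun τ => fderiv ℝ g (τ, s) (0, 1))
      (fderiv ℝ V (g (t, s)) (fderiv ℝ g (t, s) (0, 1))) t := by
  have hdg : DifferentiableAt ℝ (fderiv ℝ g) (t, s) :=
    (hg.fderiv_right (m := 1) (by norm_num)).differentiable (by norm_num) _
  have hsymm : IsSymmSndFDerivAt ℝ g (t, s) :=
    hg.contDiffAt.isSymmSndFDerivAt (by simp)
  have hline : HasDerivAt (fun τ : ℝ => (τ, s)) ((1 : ℝ), (0 : ℝ)) t :=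
    (hasDerivAt_id t).prodMk (hasDerivAt_const t s)
  have hmixed : fderiv ℝ (fderiv ℝ g) (t, s) (0, 1) (1, 0)
      = fderiv ℝ V (g (t, s)) (fderiv ℝ g (t, s) (0, 1)) := by
    have hcomp : HasFDerivAt (fun p => fderiv ℝ g p (1, 0))
        ((fderiv ℝ V (g (t, s))).comp (fderiv ℝ g (t, s))) (t, s) := by
      simp only [hgV]
      exact hV.hasFDerivAt.comp _ (hg.differentiable (by norm_num) _).hasFDerivAt
    have happly := hdg.hasFDerivAt.clm_apply (hasFDerivAt_const ((1 : ℝ), (0 : ℝ)) (t, s))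
    simpa using DFunLike.congr_fun (happly.unique hcomp) (0, 1)
  rw [← hmixed, hsymm (0, 1) (1, 0)]
  have hder : HasDerivAt (fun τ => fderiv ℝ g (τ, s)) (fderiv ℝ (fderiv ℝ g) (t, s) (1, 0)) t :=
    hdg.hasFDerivAt.comp_hasDerivAt t hline
  simpa using hder.clm_apply (hasDerivAt_const t ((0 : ℝ), (1 : ℝ)))


/-- Freire–Gasull–Guillamon formula for the first derivative of the
period function `T` along the parametrization induced by a normalizer `W` of `V`:
`T'(s) = ∫₀^{T(s)} μ(φ_V(t, z(s))) dt`. -/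
theorem period_first_derivative
    (Ω : Set (ℝ × ℝ)) (hΩ : IsOpen Ω)
    (V W : ℝ × ℝ → ℝ × ℝ) (μ : ℝ × ℝ → ℝ)
    (hV : ContDiffOn ℝ (⊤ : ℕ∞) V Ω) (hW : ContDiffOn ℝ (⊤ : ℕ∞) W Ω)
    (hμ : ContDiffOn ℝ (⊤ : ℕ∞) μ Ω)
    (hind : ∀ z ∈ Ω, LinearIndependent ℝ ![V z, W z])
    (hbracket : ∀ z ∈ Ω,
      fderiv ℝ W z (V z) - fderiv ℝ V z (W z) = μ z • V z)
    (φV : ℝ → ℝ × ℝ → ℝ × ℝ)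
    (hφmem : ∀ t : ℝ, ∀ z ∈ Ω, φV t z ∈ Ω)
    (hφsmooth : ContDiffOn ℝ (⊤ : ℕ∞)
      (fun p : ℝ × (ℝ × ℝ) => φV p.1 p.2) (Set.univ ×ˢ Ω))
    (hφ0 : ∀ z ∈ Ω, φV 0 z = z)
    (hφode : ∀ t : ℝ, ∀ z ∈ Ω, HasDerivAt (fun τ => φV τ z) (V (φV t z)) t)
    (z : ℝ → ℝ × ℝ) (hz : ∀ s, z s ∈ Ω) (hzC : ContDiff ℝ (⊤ : ℕ∞) z)
    (hzode : ∀ s, HasDerivAt z (W (z s)) s)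
    (T : ℝ → ℝ) (hT : ContDiff ℝ (⊤ : ℕ∞) T) (hTpos : ∀ s, 0 < T s)
    (hper : ∀ s, φV (T s) (z s) = z s) :
    ∀ s, deriv T s = ∫ t in (0:ℝ)..(T s), μ (φV t (z s)) := by
  intro s
  set g : ℝ × ℝ → ℝ × ℝ := fun p => φV p.1 (z p.2) with hg_def
  have hgmem : ∀ p, g p ∈ Ω := fun p => hφmem _ _ (hz _)
  have hg : ContDiff ℝ (⊤ : ℕ∞) g := by
    have hinner : ContDiff ℝ (⊤ : ℕ∞) (fun p : ℝ × ℝ => (p.1, z p.2)) := by fun_prop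
    exact hφsmooth.comp_contDiff hinner fun p => ⟨Set.mem_univ _, hz _⟩
  have hgdiff : Differentiable ℝ g := hg.differentiable (by simp)
  have hgt : ∀ p, fderiv ℝ g p (1, 0) = V (g p) := fun p =>
    ((hgdiff p).hasFDerivAt.comp_hasDerivAt p.1 (f := fun t => (t, p.2))
      ((hasDerivAt_id p.1).prodMk (hasDerivAt_const p.1 p.2))).unique (hφode p.1 _ (hz p.2))
  have hdiff : ∀ {F : ℝ × ℝ → ℝ × ℝ}, ContDiffOn ℝ (⊤ : ℕ∞) F Ω → ∀ p,
      DifferentiableAt ℝ F (g p) := fun hF p =>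
    (hF.contDiffAt (hΩ.mem_nhds (hgmem p))).differentiableAt (by simp)
  have horbit : Continuous fun t => g (t, s) := hg.continuous.comp (by fun_prop)
  have hμcont : Continuous fun t => μ (g (t, s)) :=
    hμ.continuousOn.comp_continuous horbit fun t => hgmem _
  have hVcont : Continuous fun t => fderiv ℝ V (g (t, s)) :=
    (hV.continuousOn_fderiv_of_isOpen hΩ (by simp)).comp_continuous horbit fun t => hgmem _
  have hcurve : ∀ t, HasDerivAt (fun τ => g (τ, s)) (V (g (t, s))) t :=
    fun t => hφode t _ (hz s)
  set M : ℝ → ℝ := fun t => ∫ τ in (0 : ℝ)..t, μ (g (τ, s)) with hM_def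
  have hM : ∀ t, HasDerivAt M (μ (g (t, s))) t :=
    fun t => (hμcont.integral_hasStrictDerivAt 0 t).hasDerivAt
  have hu : ∀ t, HasDerivAt
      (fun τ => fderiv ℝ g (τ, s) (0, 1) - (W (g (τ, s)) - M τ • V (g (τ, s))))
      (fderiv ℝ V (g (t, s))
        (fderiv ℝ g (t, s) (0, 1) - (W (g (t, s)) - M t • V (g (t, s))))) t := by
    intro t
    have hvar := hasDerivAt_fderiv_of_fderiv_eq_comp (hg.of_le (WithTop.coe_le_coe.2 le_top)) hgt t s
      (hdiff hV (t, s))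
    have hWt := (hdiff hW (t, s)).hasFDerivAt.comp_hasDerivAt t (hcurve t)
    have hVt := (hdiff hV (t, s)).hasFDerivAt.comp_hasDerivAt t (hcurve t)
    refine (hvar.sub (hWt.sub ((hM t).smul hVt))).congr_deriv ?_
    rw [sub_eq_iff_eq_add.mp (hbracket _ (hgmem (t, s)))]
    simp only [map_sub, map_smul, Function.comp_apply]
    abel
  have hgs : ∀ r, g (T r, r) = z r := hper
  have hinit : fderiv ℝ g (0, s) (0, 1) = W (z s) := by
    have hconst : HasDerivAt (fun r => g (0, r)) (fderiv ℝ g (0, s) (0, 1)) s :=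
      (hgdiff (0, s)).hasFDerivAt.comp_hasDerivAt s
        ((hasDerivAt_const s (0 : ℝ)).prodMk (hasDerivAt_id s))
    have hzero : (fun r => g (0, r)) = z := funext fun r => hφ0 _ (hz r)
    rw [hzero] at hconst
    exact hconst.unique (hzode s)
  have hfinal : fderiv ℝ g (T s, s) (0, 1) = W (z s) - M (T s) • V (z s) := by
    have hend := eq_zero_of_hasDerivAt_linear hVcont hu (hTpos s).le
      (by simp [hinit, hM_def, show g (0, s) = z s from hφ0 _ (hz s)])
    rw [← hgs s]
    exact sub_eq_zero.mp hend
  have hreturn : deriv T s • V (z s) + fderiv ℝ g (T s, s) (0, 1) = W (z s) := by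
    have hTs : HasDerivAt T (deriv T s) s := (hT.differentiable (by simp) s).hasDerivAt
    have hchain : HasDerivAt (fun r => g (T r, r)) (fderiv ℝ g (T s, s) (deriv T s, 1)) s :=
      (hgdiff (T s, s)).hasFDerivAt.comp_hasDerivAt s (f := fun r => (T r, r))
        (hTs.prodMk (hasDerivAt_id s))
    rw [funext hgs] at hchain
    have hsplit : ((deriv T s, 1) : ℝ × ℝ) = deriv T s • (1, 0) + (0, 1) := by simp
    rw [← hchain.unique (hzode s), hsplit, map_add, map_smul, hgt, hgs]
  have hVne : V (z s) ≠ 0 := (hind _ (hz s)).ne_zero 0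
  refine smul_left_injective ℝ hVne (?_ : deriv T s • V (z s) = M (T s) • V (z s))
  rw [hfinal] at hreturn
  linear_combination hreturn
end

section
/- Let Ω ⊆ ℝ² be open, V, W : Ω → ℝ² be C^∞ vector fields that are linearly independent at every point of Ω, and let m : Ω → ℝ be C^∞ with m > 0 on Ω and [m·V, W] = 0 on Ω. Let φ_V, φ_W : ℝ × Ω → Ω be C^∞ flows of V and W respectively, and for w ∈ Ω define ∂_W^{(n)} m(w) to be the n-th derivative at σ = 0 of σ ↦ m(φ_W(σ, w)). Let z : ℝ → Ω satisfy z'(s) = W(z(s)) and let T : ℝ → ℝ be C^∞ with T(s) > 0 and φ_V(T(s), z(s)) = z(s) for all s. Then for every n ≥ 1 and every s, the n-th derivative of T at s equals ∫₀^{T(s)} (∂_W^{(n)} m / m)(φ_V(t, z(s))) dt. -/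
open Set Filter Topology in
/-- Differentiation under the integral sign over `[0, 1]` for a `C¹` integrand. -/
theorem hasDerivAt_integral_unitInterval_of_contDiff {K : ℝ × ℝ → ℝ} (hK : ContDiff ℝ 1 K)
    (s : ℝ) :
    HasDerivAt (fun s => ∫ u in (0 : ℝ)..1, K (u, s))
      (∫ u in (0 : ℝ)..1, fderiv ℝ K (u, s) (0, 1)) s := by
  have hcont : Continuous fun p : ℝ × ℝ => fderiv ℝ K p (0, 1) :=
    (hK.continuous_fderiv one_ne_zero).clm_apply continuous_const
  obtain ⟨C, hC⟩ := ((isCompact_Icc (a := (0 : ℝ)) (b := 1)).prod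
    (isCompact_closedBall s 1)).exists_bound_of_continuousOn hcont.continuousOn
  refine (intervalIntegral.hasDerivAt_integral_of_dominated_loc_of_deriv_le
    (F := fun s u => K (u, s)) (F' := fun s u => fderiv ℝ K (u, s) (0, 1))
    (bound := fun _ => C) (Metric.closedBall_mem_nhds s one_pos) ?_ ?_ ?_ ?_ ?_ ?_).2
  · exact Eventually.of_forall fun x =>
      (hK.continuous.comp (by fun_prop : Continuous fun u : ℝ => (u, x))).aestronglyMeasurable
  · exact (hK.continuous.comp
      (by fun_prop : Continuous fun u : ℝ => (u, s))).intervalIntegrable _ _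
  · exact (hcont.comp (by fun_prop : Continuous fun u : ℝ => (u, s))).aestronglyMeasurable
  · refine Eventually.of_forall fun u hu x hx => hC (u, x) ⟨?_, hx⟩
    rw [uIoc_of_le zero_le_one] at hu
    exact Ioc_subset_Icc_self hu
  · exact intervalIntegrable_const
  · refine Eventually.of_forall fun u _ x _ => ?_
    exact ((hK.differentiable one_ne_zero (u, x)).hasFDerivAt).comp_hasDerivAt x
      ((hasDerivAt_const x u).prodMk (hasDerivAt_id x))

section

variable {E : Type*} [NormedAddCommGroup E] [NormedSpace ℝ E]

open Set in
/-- A solution of a homogeneous linear ODE which vanishes at `0` vanishes on `[0, 1]`. -/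
theorem eq_zero_of_hasDerivAt_clm_apply {A : ℝ → E →L[ℝ] E} (hA : Continuous A) {x : ℝ → E}
    (hx : ∀ u, HasDerivAt x (A u (x u)) u) (h0 : x 0 = 0) : ∀ u ∈ Icc (0 : ℝ) 1, x u = 0 := by
  obtain ⟨C, hC⟩ := (isCompact_Icc (a := (0 : ℝ)) (b := 1)).exists_bound_of_continuousOn
    hA.continuousOn
  refine eq_zero_of_abs_deriv_le_mul_abs_self_of_eq_zero_right (K := C)
    (fun u _ => (hx u).continuousAt.continuousWithinAt) (fun u _ => (hx u).hasDerivWithinAt) h0 ?_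
  exact fun u hu => (A u).le_of_opNorm_le (hC u (Ico_subset_Icc_self hu)) _

/-- If `[m • V, W] = 0`, then `[V, W] = (W m / m) • V`. -/
theorem fderiv_apply_of_smul_lieBracket_eq_zero {V W : E → E} {m : E → ℝ} {p : E}
    (hV : DifferentiableAt ℝ V p) (hm : DifferentiableAt ℝ m p) (hmp : m p ≠ 0)
    (hcomm : fderiv ℝ W p (m p • V p) - fderiv ℝ (fun w => m w • V w) p (W p) = 0) :
    fderiv ℝ W p (V p) = fderiv ℝ V p (W p) + (fderiv ℝ m p (W p) / m p) • V p := by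
  rw [fderiv_fun_smul hm hV, sub_eq_zero] at hcomm
  simp only [map_smul, add_apply, smul_apply,
    ContinuousLinearMap.smulRight_apply] at hcomm
  apply smul_right_injective E hmp
  simp only [hcomm, smul_add, smul_smul, mul_div_cancel₀ _ hmp]

/-- The variation `∂ₛΨ` of a family of trajectories of `T(s) • V` starting along a trajectory of
`W` equals `W + b • V` when `[m • V, W] = 0`. -/
theorem fderiv_trajectory_family_eq {Ω : Set E} (hΩ : IsOpen Ω) {V W : E → E} {m : E → ℝ}
    (hV : ContDiffOn ℝ (⊤ : ℕ∞) V Ω) (hW : ContDiffOn ℝ (⊤ : ℕ∞) W Ω)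
    (hm : ContDiffOn ℝ (⊤ : ℕ∞) m Ω) (hm0 : ∀ p ∈ Ω, m p ≠ 0)
    (hcomm : ∀ p ∈ Ω,
      fderiv ℝ W p (m p • V p) - fderiv ℝ (fun w => m w • V w) p (W p) = 0)
    {T : ℝ → ℝ} (hT : Differentiable ℝ T) {Ψ : ℝ × ℝ → E} (hΨ : ContDiff ℝ (⊤ : ℕ∞) Ψ)
    (hΨΩ : ∀ q, Ψ q ∈ Ω)
    (hΨV : ∀ u s, HasDerivAt (fun u => Ψ (u, s)) (T s • V (Ψ (u, s))) u)
    (hΨW : ∀ s, HasDerivAt (fun s => Ψ (0, s)) (W (Ψ (0, s))) s)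
    {s : ℝ} {b : ℝ → ℝ} (hb0 : b 0 = 0)
    (hb : ∀ u, HasDerivAt b (deriv T s -
      T s * (fderiv ℝ m (Ψ (u, s)) (W (Ψ (u, s))) / m (Ψ (u, s)))) u) :
    ∀ u ∈ Set.Icc (0 : ℝ) 1,
      fderiv ℝ Ψ (u, s) (0, 1) = W (Ψ (u, s)) + b u • V (Ψ (u, s)) := by
  have hne : ((⊤ : ℕ∞) : WithTop ℕ∞) ≠ 0 := by simp
  have hVd : ∀ q, DifferentiableAt ℝ V (Ψ q) := fun q =>
    (hV.contDiffAt (hΩ.mem_nhds (hΨΩ q))).differentiableAt hne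
  have hWd : ∀ q, DifferentiableAt ℝ W (Ψ q) := fun q =>
    (hW.contDiffAt (hΩ.mem_nhds (hΨΩ q))).differentiableAt hne
  have hmd : ∀ q, DifferentiableAt ℝ m (Ψ q) := fun q =>
    (hm.contDiffAt (hΩ.mem_nhds (hΨΩ q))).differentiableAt hne
  have hΨd : Differentiable ℝ Ψ := hΨ.differentiable hne
  have hΨ' : Differentiable ℝ (fderiv ℝ Ψ) :=
    (hΨ.fderiv_right (m := (⊤ : ℕ∞)) (by simp)).differentiable hne
  have line₁ : ∀ u s : ℝ, HasDerivAt (fun u : ℝ => (u, s)) ((1 : ℝ), (0 : ℝ)) u := fun u s =>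
    (hasDerivAt_id u).prodMk (hasDerivAt_const u s)
  have line₂ : ∀ u s : ℝ, HasDerivAt (fun s : ℝ => (u, s)) ((0 : ℝ), (1 : ℝ)) s := fun u s =>
    (hasDerivAt_const s u).prodMk (hasDerivAt_id s)
  have hΨ1 : ∀ u s, fderiv ℝ Ψ (u, s) (1, 0) = T s • V (Ψ (u, s)) := fun u s =>
    ((hΨd (u, s)).hasFDerivAt.comp_hasDerivAt u (line₁ u s)).unique (hΨV u s)
  have hΨ2 : ∀ u, HasDerivAt (fun s => Ψ (u, s)) (fderiv ℝ Ψ (u, s) (0, 1)) s := fun u =>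
    (hΨd (u, s)).hasFDerivAt.comp_hasDerivAt s (line₂ u s)
  have hY : ∀ u, HasDerivAt (fun u => fderiv ℝ Ψ (u, s) (0, 1))
      (deriv T s • V (Ψ (u, s)) + T s • fderiv ℝ V (Ψ (u, s)) (fderiv ℝ Ψ (u, s) (0, 1))) u := by
    intro u
    have h₁ : HasDerivAt (fun u => fderiv ℝ Ψ (u, s) (0, 1))
        (fderiv ℝ (fderiv ℝ Ψ) (u, s) (1, 0) (0, 1)) u := by
      have h : HasDerivAt (fun u => fderiv ℝ Ψ (u, s)) (fderiv ℝ (fderiv ℝ Ψ) (u, s) (1, 0)) u :=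
        (hΨ' (u, s)).hasFDerivAt.comp_hasDerivAt u (line₁ u s)
      exact (ContinuousLinearMap.apply ℝ E ((0 : ℝ), (1 : ℝ))).hasFDerivAt.comp_hasDerivAt u h
    have h₂ : HasDerivAt (fun s => fderiv ℝ Ψ (u, s) (1, 0))
        (fderiv ℝ (fderiv ℝ Ψ) (u, s) (0, 1) (1, 0)) s := by
      have h : HasDerivAt (fun s => fderiv ℝ Ψ (u, s)) (fderiv ℝ (fderiv ℝ Ψ) (u, s) (0, 1)) s :=
        (hΨ' (u, s)).hasFDerivAt.comp_hasDerivAt s (line₂ u s)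
      exact (ContinuousLinearMap.apply ℝ E ((1 : ℝ), (0 : ℝ))).hasFDerivAt.comp_hasDerivAt s h
    have h₃ : HasDerivAt (fun s => T s • V (Ψ (u, s)))
        (T s • fderiv ℝ V (Ψ (u, s)) (fderiv ℝ Ψ (u, s) (0, 1)) + deriv T s • V (Ψ (u, s))) s := by
      have h : HasDerivAt (fun s => V (Ψ (u, s)))
          (fderiv ℝ V (Ψ (u, s)) (fderiv ℝ Ψ (u, s) (0, 1))) s :=
        (hVd (u, s)).hasFDerivAt.comp_hasDerivAt s (hΨ2 u)
      exact (hT s).hasDerivAt.smul h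
    simp only [hΨ1] at h₂
    have hsymm := hΨ.contDiffAt.isSymmSndFDerivAt (x := (u, s))
      (by simpa using (WithTop.coe_le_coe.mpr le_top : ((2 : ℕ∞) : WithTop ℕ∞) ≤ (⊤ : ℕ∞))) (1, 0) (0, 1)
    rw [hsymm, h₂.unique h₃, add_comm] at h₁
    exact h₁
  have hzero := eq_zero_of_hasDerivAt_clm_apply
    (A := fun u => T s • fderiv ℝ V (Ψ (u, s)))
    (x := fun u => fderiv ℝ Ψ (u, s) (0, 1) - (W (Ψ (u, s)) + b u • V (Ψ (u, s)))) ?_ ?_ ?_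
  · exact fun u hu => sub_eq_zero.mp (hzero u hu)
  · have hVc : Continuous fun q => fderiv ℝ V (Ψ q) :=
      ((hV.continuousOn_fderiv_of_isOpen hΩ (by exact_mod_cast le_top)).comp_continuous
        hΨ.continuous hΨΩ)
    exact (hVc.comp (by fun_prop : Continuous fun u : ℝ => (u, s))).const_smul (T s)
  · intro u
    have hWΨ : HasDerivAt (fun u => W (Ψ (u, s)))
        (fderiv ℝ W (Ψ (u, s)) (T s • V (Ψ (u, s)))) u :=
      (hWd (u, s)).hasFDerivAt.comp_hasDerivAt u (hΨV u s)
    have hVΨ : HasDerivAt (fun u => V (Ψ (u, s)))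
        (fderiv ℝ V (Ψ (u, s)) (T s • V (Ψ (u, s)))) u :=
      (hVd (u, s)).hasFDerivAt.comp_hasDerivAt u (hΨV u s)
    refine ((hY u).sub (hWΨ.add ((hb u).smul hVΨ))).congr_deriv ?_
    have hc := fderiv_apply_of_smul_lieBracket_eq_zero (hVd (u, s)) (hmd (u, s))
      (hm0 _ (hΨΩ (u, s))) (hcomm _ (hΨΩ (u, s)))
    simp only [map_smul, hc, smul_apply, map_sub, map_add]
    module
  · have := ((hΨ2 0).unique (hΨW s))
    simp [this, hb0]

/-- The derivative in `s` of the integral of `f / m` over the closed trajectories of `V`,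
parametrized over `[0, 1]` with periods `T(s)`, is the integral of `W f / m` if `[m • V, W] = 0`. -/
theorem hasDerivAt_integral_closed_trajectories {Ω : Set E} (hΩ : IsOpen Ω) {V W : E → E}
    {m f : E → ℝ} (hV : ContDiffOn ℝ (⊤ : ℕ∞) V Ω) (hW : ContDiffOn ℝ (⊤ : ℕ∞) W Ω)
    (hm : ContDiffOn ℝ (⊤ : ℕ∞) m Ω) (hm0 : ∀ p ∈ Ω, m p ≠ 0) (hV0 : ∀ p ∈ Ω, V p ≠ 0)
    (hcomm : ∀ p ∈ Ω,
      fderiv ℝ W p (m p • V p) - fderiv ℝ (fun w => m w • V w) p (W p) = 0)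
    (hf : ContDiffOn ℝ (⊤ : ℕ∞) f Ω)
    {T : ℝ → ℝ} (hT : ContDiff ℝ (⊤ : ℕ∞) T) {Ψ : ℝ × ℝ → E} (hΨ : ContDiff ℝ (⊤ : ℕ∞) Ψ)
    (hΨΩ : ∀ q, Ψ q ∈ Ω)
    (hΨV : ∀ u s, HasDerivAt (fun u => Ψ (u, s)) (T s • V (Ψ (u, s))) u)
    (hΨW : ∀ s, HasDerivAt (fun s => Ψ (0, s)) (W (Ψ (0, s))) s)
    (hper : ∀ s, Ψ (1, s) = Ψ (0, s)) (s : ℝ) :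
    HasDerivAt (fun s => ∫ u in (0 : ℝ)..1, T s * (f (Ψ (u, s)) / m (Ψ (u, s))))
      (∫ u in (0 : ℝ)..1,
        T s * (fderiv ℝ f (Ψ (u, s)) (W (Ψ (u, s))) / m (Ψ (u, s)))) s := by
  have hne : ((⊤ : ℕ∞) : WithTop ℕ∞) ≠ 0 := by simp
  have hΨu : Continuous fun u : ℝ => Ψ (u, s) := hΨ.continuous.comp (by fun_prop)
  have hmΨ : Continuous fun u : ℝ => m (Ψ (u, s)) :=
    hm.continuousOn.comp_continuous hΨu fun _ => hΨΩ _
  have hWΨ : Continuous fun u : ℝ => W (Ψ (u, s)) :=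
    hW.continuousOn.comp_continuous hΨu fun _ => hΨΩ _
  have hdW : ∀ {h : E → ℝ}, ContDiffOn ℝ (⊤ : ℕ∞) h Ω →
      Continuous fun u : ℝ => fderiv ℝ h (Ψ (u, s)) (W (Ψ (u, s))) / m (Ψ (u, s)) := fun hh =>
    (((hh.continuousOn_fderiv_of_isOpen hΩ (by exact_mod_cast le_top)).comp_continuous
      hΨu fun _ => hΨΩ _).clm_apply hWΨ).div hmΨ fun _ => hm0 _ (hΨΩ _)
  have hfd : ∀ {h : E → ℝ}, ContDiffOn ℝ (⊤ : ℕ∞) h Ω → ∀ q, DifferentiableAt ℝ h (Ψ q) :=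
    fun hh q => (hh.contDiffAt (hΩ.mem_nhds (hΨΩ q))).differentiableAt hne
  let c : ℝ → ℝ := fun u =>
    deriv T s - T s * (fderiv ℝ m (Ψ (u, s)) (W (Ψ (u, s))) / m (Ψ (u, s)))
  have hc : Continuous c := continuous_const.sub (continuous_const.mul (hdW hm))
  let b : ℝ → ℝ := fun u => ∫ v in (0 : ℝ)..u, c v
  have hb0 : b 0 = 0 := intervalIntegral.integral_same
  have hb : ∀ u, HasDerivAt b (c u) u := fun u => hc.integral_hasStrictDerivAt 0 u |>.hasDerivAt
  have hY := fderiv_trajectory_family_eq hΩ hV hW hm hm0 hcomm (hT.differentiable hne) hΨ hΨΩ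
    hΨV hΨW hb0 hb
  have hΨs : ∀ u, HasDerivAt (fun s => Ψ (u, s)) (fderiv ℝ Ψ (u, s) (0, 1)) s := fun u =>
    (hΨ.differentiable hne (u, s)).hasFDerivAt.comp_hasDerivAt s
      ((hasDerivAt_const s u).prodMk (hasDerivAt_id s))
  have hb1 : b 1 = 0 := by
    have h := hΨs 1
    rw [hY 1 (by simp)] at h
    simp only [hper] at h
    simpa [hV0 _ (hΨΩ (0, s))] using h.unique (hΨW s)
  let g : E → ℝ := fun p => f p / m p
  have hg : ContDiffOn ℝ (⊤ : ℕ∞) g Ω := hf.div hm hm0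
  let K : ℝ × ℝ → ℝ := fun q => T q.2 * g (Ψ q)
  have hK : ContDiff ℝ (⊤ : ℕ∞) K :=
    (hT.comp contDiff_snd).mul (hg.comp_contDiff hΨ hΨΩ)
  have hmain := hasDerivAt_integral_unitInterval_of_contDiff
    (hK.of_le (by exact_mod_cast le_top)) s
  refine hmain.congr_deriv ?_
  have hbg : ∀ u, HasDerivAt (fun u => b u * g (Ψ (u, s)))
      (c u * g (Ψ (u, s)) + b u * fderiv ℝ g (Ψ (u, s)) (T s • V (Ψ (u, s)))) u := by
    intro u
    have h : HasDerivAt (fun u => g (Ψ (u, s)))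
        (fderiv ℝ g (Ψ (u, s)) (T s • V (Ψ (u, s)))) u :=
      (hfd hg (u, s)).hasFDerivAt.comp_hasDerivAt (l := g) u (hΨV u s)
    exact (hb u).mul h
  have hVΨ : Continuous fun u : ℝ => V (Ψ (u, s)) :=
    hV.continuousOn.comp_continuous hΨu fun _ => hΨΩ _
  have hbc : Continuous b := continuous_iff_continuousAt.mpr fun u => (hb u).continuousAt
  have hbg' : Continuous fun u =>
      c u * g (Ψ (u, s)) + b u * fderiv ℝ g (Ψ (u, s)) (T s • V (Ψ (u, s))) :=
    (hc.mul (hg.continuousOn.comp_continuous hΨu fun _ => hΨΩ _)).add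
      (hbc.mul (((hg.continuousOn_fderiv_of_isOpen hΩ (by exact_mod_cast le_top)).comp_continuous
        hΨu fun _ => hΨΩ _).clm_apply (hVΨ.const_smul _)))
  have hFTC := intervalIntegral.integral_eq_sub_of_hasDerivAt (a := 0) (b := 1)
    (fun u _ => hbg u) (hbg'.intervalIntegrable 0 1)
  rw [hb0, hb1, zero_mul, zero_mul, sub_zero] at hFTC
  have hfm : Continuous fun u : ℝ =>
      T s * (fderiv ℝ f (Ψ (u, s)) (W (Ψ (u, s))) / m (Ψ (u, s))) :=
    continuous_const.mul (hdW hf)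
  have hsum := intervalIntegral.integral_add (hbg'.intervalIntegrable (μ := MeasureTheory.volume)
    0 1) (hfm.intervalIntegrable 0 1)
  rw [hFTC, zero_add] at hsum
  rw [← hsum]
  refine intervalIntegral.integral_congr fun u hu => ?_
  rw [Set.uIcc_of_le zero_le_one] at hu
  have hKs : HasDerivAt (fun s => K (u, s)) (fderiv ℝ K (u, s) (0, 1)) s :=
    (hK.differentiable hne (u, s)).hasFDerivAt.comp_hasDerivAt s
      ((hasDerivAt_const s u).prodMk (hasDerivAt_id s))
  have hKs' : HasDerivAt (fun s => K (u, s)) (deriv T s * g (Ψ (u, s)) +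
      T s * fderiv ℝ g (Ψ (u, s)) (fderiv ℝ Ψ (u, s) (0, 1))) s := by
    have h : HasDerivAt (fun s => g (Ψ (u, s)))
        (fderiv ℝ g (Ψ (u, s)) (fderiv ℝ Ψ (u, s) (0, 1))) s :=
      (hfd hg (u, s)).hasFDerivAt.comp_hasDerivAt (l := g) s (hΨs u)
    exact (hT.differentiable hne s).hasDerivAt.mul h
  have hmp := hm0 _ (hΨΩ (u, s))
  have hgW : fderiv ℝ g (Ψ (u, s)) (W (Ψ (u, s))) =
      (fderiv ℝ f (Ψ (u, s)) (W (Ψ (u, s))) * m (Ψ (u, s)) -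
        f (Ψ (u, s)) * fderiv ℝ m (Ψ (u, s)) (W (Ψ (u, s)))) / m (Ψ (u, s)) ^ 2 := by
    have hline : HasDerivAt (fun t : ℝ => Ψ (u, s) + t • W (Ψ (u, s))) (W (Ψ (u, s))) 0 := by
      simpa using ((hasDerivAt_id (0 : ℝ)).smul_const (W (Ψ (u, s)))).const_add (Ψ (u, s))
    have along : ∀ {h : E → ℝ}, ContDiffOn ℝ (⊤ : ℕ∞) h Ω →
        HasDerivAt (fun t : ℝ => h (Ψ (u, s) + t • W (Ψ (u, s))))
          (fderiv ℝ h (Ψ (u, s)) (W (Ψ (u, s)))) 0 := fun hh =>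
      (hfd hh (u, s)).hasFDerivAt.comp_hasDerivAt_of_eq 0 hline (by simp)
    have h := (along hf).div (along hm) (by simpa using hmp)
    simpa using (along hg).unique h
  simp only [hKs.unique hKs', hY u hu, map_add, map_smul, smul_eq_mul, hgW, c, g]
  field_simp
  ring

/-- The derivative of a function along a vector field is smooth if both are. -/
theorem ContDiffOn.fderiv_apply_vectorField {Ω : Set E} (hΩ : IsOpen Ω) {W : E → E} {f : E → ℝ}
    (hW : ContDiffOn ℝ (⊤ : ℕ∞) W Ω) (hf : ContDiffOn ℝ (⊤ : ℕ∞) f Ω) :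
    ContDiffOn ℝ (⊤ : ℕ∞) (fun p => fderiv ℝ f p (W p)) Ω :=
  (hf.fderiv_of_isOpen hΩ (by simp)).clm_apply hW

/-- The iterated derivatives of a smooth function along a smooth vector field are smooth. -/
theorem contDiffOn_iterate_fderiv_apply {Ω : Set E} (hΩ : IsOpen Ω) {W : E → E} {f : E → ℝ}
    (hW : ContDiffOn ℝ (⊤ : ℕ∞) W Ω) (hf : ContDiffOn ℝ (⊤ : ℕ∞) f Ω) (n : ℕ) :
    ContDiffOn ℝ (⊤ : ℕ∞) ((fun (h : E → ℝ) p => fderiv ℝ h p (W p))^[n] f) Ω := by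
  induction n with
  | zero => exact hf
  | succ n ih =>
    rw [Function.iterate_succ_apply']
    exact hW.fderiv_apply_vectorField hΩ ih

/-- The iterated derivatives of `f` along a trajectory of `W` are given by iterating the
directional derivative along `W`. -/
theorem iteratedDeriv_comp_trajectory {Ω : Set E} (hΩ : IsOpen Ω) {W : E → E} {f : E → ℝ}
    (hW : ContDiffOn ℝ (⊤ : ℕ∞) W Ω) (hf : ContDiffOn ℝ (⊤ : ℕ∞) f Ω) {γ : ℝ → E}
    (hγΩ : ∀ σ, γ σ ∈ Ω) (hγ : ∀ σ, HasDerivAt γ (W (γ σ)) σ) (n : ℕ) :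
    iteratedDeriv n (fun σ => f (γ σ)) =
      fun σ => (fun (h : E → ℝ) p => fderiv ℝ h p (W p))^[n] f (γ σ) := by
  induction n with
  | zero => simp
  | succ n ih =>
    funext σ
    rw [iteratedDeriv_succ, ih, Function.iterate_succ_apply']
    exact (((contDiffOn_iterate_fderiv_apply hΩ hW hf n).contDiffAt
      (hΩ.mem_nhds (hγΩ σ))).differentiableAt (by simp)).hasFDerivAt.comp_hasDerivAt σ
        (hγ σ) |>.deriv

/-- Trajectories of smooth vector fields are smooth. -/
theorem contDiff_of_hasDerivAt_vectorField {Ω : Set E} {W : E → E}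
    (hW : ContDiffOn ℝ (⊤ : ℕ∞) W Ω) {γ : ℝ → E}
    (hγΩ : ∀ s, γ s ∈ Ω) (hγ : ∀ s, HasDerivAt γ (W (γ s)) s) : ContDiff ℝ (⊤ : ℕ∞) γ := by
  have hd : Differentiable ℝ γ := fun s => (hγ s).differentiableAt
  rw [contDiff_infty]
  intro n
  induction n with
  | zero => exact contDiff_zero.mpr hd.continuous
  | succ n ih =>
    have hderiv : deriv γ = fun s => W (γ s) := funext fun s => (hγ s).deriv
    push_cast
    rw [contDiff_succ_iff_deriv, hderiv]
    exact ⟨hd, by simp, (hW.of_le (by exact_mod_cast le_top)).comp_contDiff ih hγΩ⟩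

end


/-- if `m` is a positive C-factor (`[m·V, W] = 0`), then the `n`-th
derivative of the period function along the parametrization induced by `W` is
`∂_W^{(n)} T(s) = ∫₀^{T(s)} (∂_W^{(n)} m / m)(φ_V(t, z(s))) dt`. -/
theorem period_nth_derivative_C_factor
    (Ω : Set (ℝ × ℝ)) (hΩ : IsOpen Ω)
    (V W : ℝ × ℝ → ℝ × ℝ) (m : ℝ × ℝ → ℝ)
    (hV : ContDiffOn ℝ (⊤ : ℕ∞) V Ω) (hW : ContDiffOn ℝ (⊤ : ℕ∞) W Ω)
    (hm : ContDiffOn ℝ (⊤ : ℕ∞) m Ω) (hmpos : ∀ z ∈ Ω, 0 < m z)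
    (hind : ∀ z ∈ Ω, LinearIndependent ℝ ![V z, W z])
    (hcomm : ∀ z ∈ Ω,
      fderiv ℝ W z (m z • V z) - fderiv ℝ (fun w => m w • V w) z (W z) = 0)
    (φV φW : ℝ → ℝ × ℝ → ℝ × ℝ)
    (hφVmem : ∀ t : ℝ, ∀ z ∈ Ω, φV t z ∈ Ω)
    (hφVsmooth : ContDiffOn ℝ (⊤ : ℕ∞)
      (fun p : ℝ × (ℝ × ℝ) => φV p.1 p.2) (Set.univ ×ˢ Ω))
    (hφV0 : ∀ z ∈ Ω, φV 0 z = z)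
    (hφVode : ∀ t : ℝ, ∀ z ∈ Ω, HasDerivAt (fun τ => φV τ z) (V (φV t z)) t)
    (hφWmem : ∀ σ : ℝ, ∀ z ∈ Ω, φW σ z ∈ Ω)
    (hφWsmooth : ContDiffOn ℝ (⊤ : ℕ∞)
      (fun p : ℝ × (ℝ × ℝ) => φW p.1 p.2) (Set.univ ×ˢ Ω))
    (hφW0 : ∀ z ∈ Ω, φW 0 z = z)
    (hφWode : ∀ σ : ℝ, ∀ z ∈ Ω, HasDerivAt (fun τ => φW τ z) (W (φW σ z)) σ)
    (z : ℝ → ℝ × ℝ) (hz : ∀ s, z s ∈ Ω)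
    (hzode : ∀ s, HasDerivAt z (W (z s)) s)
    (T : ℝ → ℝ) (hT : ContDiff ℝ (⊤ : ℕ∞) T) (hTpos : ∀ s, 0 < T s)
    (hper : ∀ s, φV (T s) (z s) = z s) :
    ∀ n : ℕ, 1 ≤ n → ∀ s,
      iteratedDeriv n T s =
        ∫ t in (0:ℝ)..(T s),
          iteratedDeriv n (fun σ => m (φW σ (φV t (z s)))) 0 / m (φV t (z s)) := by
  intro n _ s
  have hzs : ContDiff ℝ (⊤ : ℕ∞) z := contDiff_of_hasDerivAt_vectorField hW hz hzode
  let Ψ : ℝ × ℝ → ℝ × ℝ := fun q => φV (q.1 * T q.2) (z q.2)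
  have hΨ : ContDiff ℝ (⊤ : ℕ∞) Ψ :=
    hφVsmooth.comp_contDiff (f := fun q : ℝ × ℝ => (q.1 * T q.2, z q.2))
      ((contDiff_fst.mul (hT.comp contDiff_snd)).prodMk (hzs.comp contDiff_snd))
      fun q => ⟨Set.mem_univ _, hz _⟩
  have hΨΩ : ∀ q, Ψ q ∈ Ω := fun q => hφVmem _ _ (hz _)
  have hΨV : ∀ u s, HasDerivAt (fun u => Ψ (u, s)) (T s • V (Ψ (u, s))) u := by
    intro u s
    have h : HasDerivAt (fun u : ℝ => u * T s) (T s) u := by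
      simpa using (hasDerivAt_id u).mul_const (T s)
    exact (hφVode (u * T s) (z s) (hz s)).scomp u h
  have hΨ0 : ∀ s, Ψ (0, s) = z s := fun s => by simp [Ψ, hφV0 _ (hz s)]
  have hΨW : ∀ s, HasDerivAt (fun s => Ψ (0, s)) (W (Ψ (0, s))) s := by
    simpa only [hΨ0] using hzode
  have hΨ1 : ∀ s, Ψ (1, s) = Ψ (0, s) := fun s => by rw [hΨ0]; simp [Ψ, hper]
  have hm0 : ∀ p ∈ Ω, m p ≠ 0 := fun p hp => (hmpos p hp).ne'
  have hV0 : ∀ p ∈ Ω, V p ≠ 0 := fun p hp => (hind p hp).ne_zero 0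
  let L : (ℝ × ℝ → ℝ) → ℝ × ℝ → ℝ := fun h p => fderiv ℝ h p (W p)
  have key : ∀ n : ℕ, iteratedDeriv n T =
      fun s => ∫ u in (0 : ℝ)..1, T s * (L^[n] m (Ψ (u, s)) / m (Ψ (u, s))) := by
    intro n
    induction n with
    | zero =>
      funext s
      simp [div_self (hm0 _ (hΨΩ _))]
    | succ n ih =>
      funext s
      rw [iteratedDeriv_succ, ih, Function.iterate_succ_apply']
      exact (hasDerivAt_integral_closed_trajectories hΩ hV hW hm hm0 hV0 hcomm
        (contDiffOn_iterate_fderiv_apply hΩ hW hm n) hT hΨ hΨΩ hΨV hΨW hΨ1 s).deriv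
  have hiter : ∀ t, iteratedDeriv n (fun σ => m (φW σ (φV t (z s)))) 0 =
      L^[n] m (φV t (z s)) := fun t => by
    have hp := hφVmem t _ (hz s)
    rw [iteratedDeriv_comp_trajectory hΩ hW hm (γ := fun σ => φW σ (φV t (z s)))
      (fun σ => hφWmem σ _ hp) (fun σ => hφWode σ _ hp) n]
    simp only [hφW0 _ hp, L]
  simp only [hiter, key]
  rw [intervalIntegral.integral_const_mul]
  have := intervalIntegral.mul_integral_comp_mul_right (a := 0) (b := 1)
    (f := fun t => L^[n] m (φV t (z s)) / m (φV t (z s))) (T s)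
  simpa using this
end

section
/- Let Ω ⊆ ℝ² be open, V, W : Ω → ℝ² be C¹ vector fields with V(z) ≠ 0 for all z ∈ Ω, and let m, m̄ : Ω → ℝ be C¹ functions with m > 0 and m̄ > 0 on Ω. (a) If [m·V, W] = 0 and [m̄·V, W] = 0 on Ω, then ∂_W(m̄/m) = 0 on Ω (i.e. m̄/m is a first integral of W). (b) Conversely, if [m·V, W] = 0 on Ω and J : Ω → ℝ is a C¹ function with ∂_W J = 0 on Ω, then [J·m·V, W] = 0 on Ω. -/
/-- Leibniz rule for the Lie bracket: `[f U, W] = f [U, W] - (∂_W f) U`. -/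
theorem fderiv_apply_smul_sub_fderiv_smul_apply
    {E : Type*} [NormedAddCommGroup E] [NormedSpace ℝ E] {f : E → ℝ} {U W : E → E} {z : E}
    (hf : DifferentiableAt ℝ f z) (hU : DifferentiableAt ℝ U z) :
    fderiv ℝ W z (f z • U z) - fderiv ℝ (fun w => f w • U w) z (W z)
      = f z • (fderiv ℝ W z (U z) - fderiv ℝ U z (W z)) - fderiv ℝ f z (W z) • U z := by
  have h : fderiv ℝ (fun w => f w • U w) z (W z)
      = f z • fderiv ℝ U z (W z) + fderiv ℝ f z (W z) • U z := by
    rw [(hf.hasFDerivAt.fun_smul hU.hasFDerivAt).fderiv]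
    simp
  rw [h, map_smul, smul_sub]
  abel


/-- (a) two positive C-factors of `V` w.r.t. `W` differ by a first
integral of `W`: `∂_W (m̄/m) = 0`. (b) Conversely, multiplying a C-factor by a
first integral `J` of `W` yields again a C-factor. -/
theorem C_factors_differ_by_first_integral
    (Ω : Set (ℝ × ℝ)) (hΩ : IsOpen Ω)
    (V W : ℝ × ℝ → ℝ × ℝ)
    (hV : ContDiffOn ℝ 1 V Ω) (hW : ContDiffOn ℝ 1 W Ω)
    (hVne : ∀ z ∈ Ω, V z ≠ 0)
    (m mbar : ℝ × ℝ → ℝ)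
    (hm : ContDiffOn ℝ 1 m Ω) (hmbar : ContDiffOn ℝ 1 mbar Ω)
    (hmpos : ∀ z ∈ Ω, 0 < m z) (hmbarpos : ∀ z ∈ Ω, 0 < mbar z) :
    ((∀ z ∈ Ω,
        fderiv ℝ W z (m z • V z)
          - fderiv ℝ (fun w => m w • V w) z (W z) = 0) →
     (∀ z ∈ Ω,
        fderiv ℝ W z (mbar z • V z)
          - fderiv ℝ (fun w => mbar w • V w) z (W z) = 0) →
     ∀ z ∈ Ω, fderiv ℝ (fun w => mbar w / m w) z (W z) = 0)
    ∧
    (∀ J : ℝ × ℝ → ℝ, ContDiffOn ℝ 1 J Ω →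
      (∀ z ∈ Ω, fderiv ℝ J z (W z) = 0) →
      (∀ z ∈ Ω,
        fderiv ℝ W z (m z • V z)
          - fderiv ℝ (fun w => m w • V w) z (W z) = 0) →
      ∀ z ∈ Ω,
        fderiv ℝ W z ((J z * m z) • V z)
          - fderiv ℝ (fun w => (J w * m w) • V w) z (W z) = 0) := by
  have diff {F : Type} [NormedAddCommGroup F] [NormedSpace ℝ F] {g : ℝ × ℝ → F}
      (hg : ContDiffOn ℝ 1 g Ω) {z : ℝ × ℝ} (hz : z ∈ Ω) : DifferentiableAt ℝ g z :=
    (hg.contDiffAt (hΩ.mem_nhds hz)).differentiableAt one_ne_zero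
  refine ⟨fun h₁ h₂ z hz => ?_, fun J hJ hJW h z hz => ?_⟩
  · have hq : DifferentiableAt ℝ (fun w => mbar w / m w) z :=
      diff (hmbar.div hm fun w hw => (hmpos w hw).ne') hz
    have hU : DifferentiableAt ℝ (fun w => m w • V w) z := (diff hm hz).fun_smul (diff hV hz)
    have key := fderiv_apply_smul_sub_fderiv_smul_apply (W := W) hq hU
    have hcancel : ∀ w ∈ Ω, (mbar w / m w) • m w • V w = mbar w • V w := fun w hw => by
      rw [smul_smul, div_mul_cancel₀ _ (hmpos w hw).ne']
    have hev : (fun w => (mbar w / m w) • m w • V w) =ᶠ[nhds z] fun w => mbar w • V w :=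
      Filter.eventually_of_mem (hΩ.mem_nhds hz) hcancel
    rw [hev.fderiv_eq, hcancel z hz, h₂ z hz, h₁ z hz, smul_zero, zero_sub, eq_comm, neg_eq_zero,
      smul_eq_zero] at key
    exact key.resolve_right (smul_ne_zero (hmpos z hz).ne' (hVne z hz))
  · have key := fderiv_apply_smul_sub_fderiv_smul_apply (W := W) (diff hJ hz)
      ((diff hm hz).fun_smul (diff hV hz))
    rw [h z hz, hJW z hz, smul_zero, zero_smul, sub_zero] at key
    simpa only [mul_smul] using key
end

section
/- Let Ω ⊆ ℝ² be open, V, W : Ω → ℝ² be C^∞ vector fields that are linearly independent at every point of Ω, and μ : Ω → ℝ be C^∞ with [V,W] = μ·V on Ω. Let φ_V : ℝ × Ω → Ω be a C^∞ flow of V, let z : ℝ → Ω satisfy z'(s) = W(z(s)), and let T : ℝ → ℝ be C^∞ with T(s) > 0 and φ_V(T(s), z(s)) = z(s) for all s. If ∂_W μ ≥ 0 on Ω, then T''(s) ≥ 0 for all s (T is W-convex). If moreover for every s there exists t ∈ [0, T(s)] with (μ² + ∂_W μ)(φ_V(t, z(s))) > 0, then T''(s) > 0 for all s. -/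
open Set Filter Topology MeasureTheory

/-- Differentiation under the integral sign for integrands with jointly continuous derivative. -/
theorem hasDerivAt_intervalIntegral_of_continuous_deriv {a b : ℝ} {g g' : ℝ → ℝ → ℝ}
    (hg : ∀ s, Continuous (g s)) (hg' : Continuous fun p : ℝ × ℝ => g' p.1 p.2)
    (hd : ∀ s u, HasDerivAt (fun σ => g σ u) (g' s u) s) (s : ℝ) :
    HasDerivAt (fun σ => ∫ u in a..b, g σ u) (∫ u in a..b, g' s u) s := by
  obtain ⟨C, hC⟩ := ((isCompact_closedBall s 1).prod (isCompact_uIcc (a := a) (b := b)))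
    |>.exists_bound_of_continuousOn hg'.continuousOn
  refine (intervalIntegral.hasDerivAt_integral_of_dominated_loc_of_deriv_le
    (bound := fun _ => C) (Metric.closedBall_mem_nhds s one_pos)
    (Eventually.of_forall fun σ => (hg σ).aestronglyMeasurable)
    ((hg s).intervalIntegrable _ _) ?_ ?_ intervalIntegrable_const ?_).2
  · exact (hg'.comp (by fun_prop : Continuous fun u : ℝ => (s, u))).aestronglyMeasurable
  · exact ae_of_all _ fun u hu σ hσ => hC (σ, u) ⟨hσ, uIoc_subset_uIcc hu⟩
  · exact ae_of_all _ fun u _ σ _ => hd σ u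

/-- Uniqueness, forward in time, of solutions of `x' = A(t) x` with `A` continuous. -/
theorem eq_of_hasDerivAt_clm_apply {E : Type*} [NormedAddCommGroup E] [NormedSpace ℝ E]
    {A : ℝ → E →L[ℝ] E} (hA : Continuous A) {f g : ℝ → E} {t₀ : ℝ}
    (hf : ∀ t, HasDerivAt f (A t (f t)) t) (hg : ∀ t, HasDerivAt g (A t (g t)) t)
    (h₀ : f t₀ = g t₀) {t : ℝ} (ht : t₀ ≤ t) : f t = g t := by
  obtain ⟨C, hC⟩ := (isCompact_Icc (a := t₀) (b := t)).exists_bound_of_continuousOn hA.continuousOn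
  have hLip : ∀ τ ∈ Ico t₀ t, LipschitzOnWith C.toNNReal (A τ) univ := fun τ hτ =>
    ((A τ).lipschitz.weaken (by
      rw [← NNReal.coe_le_coe, coe_nnnorm]
      exact (hC τ (Ico_subset_Icc_self hτ)).trans (Real.le_coe_toNNReal C))).lipschitzOnWith
  exact ODE_solution_unique_of_mem_Icc_right (v := fun t => A t) hLip
    (fun τ _ => (hf τ).continuousAt.continuousWithinAt) (fun τ _ => (hf τ).hasDerivWithinAt)
    (fun _ _ => mem_univ _)
    (fun τ _ => (hg τ).continuousAt.continuousWithinAt) (fun τ _ => (hg τ).hasDerivWithinAt)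
    (fun _ _ => mem_univ _) h₀ (right_mem_Icc.2 ht)

section Flow

variable {E : Type*} [NormedAddCommGroup E] [NormedSpace ℝ E] {Ω : Set E} {V W : E → E}
  {φ : ℝ → E → E}

/-- A smooth flow is jointly differentiable in time and space. -/
theorem hasFDerivAt_flow (hΩ : IsOpen Ω)
    (hφ : ContDiffOn ℝ (⊤ : ℕ∞) (fun p : ℝ × E => φ p.1 p.2) (univ ×ˢ Ω))
    {z : E} (hz : z ∈ Ω) (t : ℝ) :
    HasFDerivAt (fun p : ℝ × E => φ p.1 p.2)
      (fderiv ℝ (fun p : ℝ × E => φ p.1 p.2) (t, z)) (t, z) :=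
  ((hφ.contDiffAt ((isOpen_univ.prod hΩ).mem_nhds ⟨mem_univ _, hz⟩)).differentiableAt
    (by simp)).hasFDerivAt

/-- The time derivative of a flow is the vector field. -/
theorem fderiv_flow_apply_one_zero (hΩ : IsOpen Ω)
    (hφ : ContDiffOn ℝ (⊤ : ℕ∞) (fun p : ℝ × E => φ p.1 p.2) (univ ×ˢ Ω))
    (hφode : ∀ t, ∀ z ∈ Ω, HasDerivAt (fun τ => φ τ z) (V (φ t z)) t)
    {z : E} (hz : z ∈ Ω) (t : ℝ) :
    fderiv ℝ (fun p : ℝ × E => φ p.1 p.2) (t, z) (1, 0) = V (φ t z) := by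
  have h : HasDerivAt (fun τ => φ τ z)
      (fderiv ℝ (fun p : ℝ × E => φ p.1 p.2) (t, z) (1, 0)) t :=
    HasFDerivAt.comp_hasDerivAt (f := fun τ => (τ, z)) t (hasFDerivAt_flow hΩ hφ hz t)
      ((hasDerivAt_id t).prodMk (hasDerivAt_const t z))
  exact h.unique (hφode t z hz)

/-- The spatial derivative of a flow solves the variational equation. -/
theorem hasDerivAt_fderiv_flow (hΩ : IsOpen Ω) (hV : ContDiffOn ℝ (⊤ : ℕ∞) V Ω)
    (hφmem : ∀ t, ∀ z ∈ Ω, φ t z ∈ Ω)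
    (hφ : ContDiffOn ℝ (⊤ : ℕ∞) (fun p : ℝ × E => φ p.1 p.2) (univ ×ˢ Ω))
    (hφode : ∀ t, ∀ z ∈ Ω, HasDerivAt (fun τ => φ τ z) (V (φ t z)) t)
    {z : E} (hz : z ∈ Ω) (w : E) (t : ℝ) :
    HasDerivAt (fun τ => fderiv ℝ (fun p : ℝ × E => φ p.1 p.2) (τ, z) (0, w))
      (fderiv ℝ V (φ t z) (fderiv ℝ (fun p : ℝ × E => φ p.1 p.2) (t, z) (0, w))) t := by
  have htime : ∀ p ∈ (univ ×ˢ Ω : Set (ℝ × E)),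
      fderiv ℝ (fun p : ℝ × E => φ p.1 p.2) p (1, 0) = V (φ p.1 p.2) := fun p hp =>
    fderiv_flow_apply_one_zero hΩ hφ hφode hp.2 p.1
  have hVd : HasFDerivAt V (fderiv ℝ V (φ t z)) (φ t z) :=
    ((hV.contDiffAt (hΩ.mem_nhds (hφmem t z hz))).differentiableAt (by simp)).hasFDerivAt
  have hU : (univ ×ˢ Ω : Set (ℝ × E)) ∈ 𝓝 (t, z) :=
    (isOpen_univ.prod hΩ).mem_nhds ⟨mem_univ _, hz⟩
  have hsm := hφ.contDiffAt hU
  have hFz : φ t z = (fun p : ℝ × E => φ p.1 p.2) (t, z) := rfl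
  rw [hFz] at hVd ⊢
  change ∀ p ∈ (univ ×ˢ Ω : Set (ℝ × E)), fderiv ℝ (fun p : ℝ × E => φ p.1 p.2) p (1, 0) =
    V ((fun p : ℝ × E => φ p.1 p.2) p) at htime
  generalize (fun p : ℝ × E => φ p.1 p.2) = F at *
  have hFd : HasFDerivAt F (fderiv ℝ F (t, z)) (t, z) :=
    (hsm.differentiableAt (by simp)).hasFDerivAt
  have hF' : HasFDerivAt (fderiv ℝ F) (fderiv ℝ (fderiv ℝ F) (t, z)) (t, z) :=
    ((hsm.fderiv_right (m := 1) (by norm_cast)).differentiableAt (by simp)).hasFDerivAt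
  have hsymm : IsSymmSndFDerivAt ℝ F (t, z) :=
    hsm.isSymmSndFDerivAt (by simp; norm_cast)
  have h1 : HasFDerivAt (fun p => fderiv ℝ F p (1, 0))
      ((fderiv ℝ V (F (t, z))).comp (fderiv ℝ F (t, z))) (t, z) :=
    (hVd.comp (t, z) hFd).congr_of_eventuallyEq (eventually_of_mem hU htime)
  have h2 : HasFDerivAt (fun p => fderiv ℝ F p (1, 0))
      ((fderiv ℝ (fderiv ℝ F) (t, z)).flip (1, 0)) (t, z) := by
    simpa using hF'.clm_apply (hasFDerivAt_const ((1 : ℝ), (0 : E)) (t, z))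
  have h3 : HasDerivAt (fun τ => fderiv ℝ F (τ, z))
      (fderiv ℝ (fderiv ℝ F) (t, z) (1, 0)) t :=
    hF'.comp_hasDerivAt t ((hasDerivAt_id t).prodMk (hasDerivAt_const t z))
  have h4 := DFunLike.congr_fun (h2.unique h1) (0, w)
  simp only [ContinuousLinearMap.flip_apply, ContinuousLinearMap.comp_apply] at h4
  refine (h3.clm_apply (hasDerivAt_const t ((0 : ℝ), w))).congr_deriv ?_
  rw [map_zero, add_zero, hsymm (1, 0) (0, w), h4]

/-- If `[V, W] = μ V`, the flow of `V` carries `W` to `W - (∫ μ) V`. Stated with an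
additional time component `a`. -/
theorem fderiv_flow_apply_eq_of_bracket (hΩ : IsOpen Ω) (hV : ContDiffOn ℝ (⊤ : ℕ∞) V Ω)
    (hW : ContDiffOn ℝ (⊤ : ℕ∞) W Ω) {μ : E → ℝ} (hμ : ContinuousOn μ Ω)
    (hbracket : ∀ z ∈ Ω, fderiv ℝ W z (V z) - fderiv ℝ V z (W z) = μ z • V z)
    (hφmem : ∀ t, ∀ z ∈ Ω, φ t z ∈ Ω)
    (hφ : ContDiffOn ℝ (⊤ : ℕ∞) (fun p : ℝ × E => φ p.1 p.2) (univ ×ˢ Ω))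
    (hφ0 : ∀ z ∈ Ω, φ 0 z = z)
    (hφode : ∀ t, ∀ z ∈ Ω, HasDerivAt (fun τ => φ τ z) (V (φ t z)) t)
    {z : E} (hz : z ∈ Ω) {t : ℝ} (ht : 0 ≤ t) (a : ℝ) :
    fderiv ℝ (fun p : ℝ × E => φ p.1 p.2) (t, z) (a, W z) =
      a • V (φ t z) + (W (φ t z) - (∫ τ in (0 : ℝ)..t, μ (φ τ z)) • V (φ t z)) := by
  have hsplit : ((a, W z) : ℝ × E) = a • (1, 0) + (0, W z) := by simp
  rw [hsplit, map_add, map_smul, fderiv_flow_apply_one_zero hΩ hφ hφode hz]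
  congr 1
  have hγ : Continuous fun τ => φ τ z :=
    continuous_iff_continuousAt.2 fun τ => (hφode τ z hz).continuousAt
  have hμγ : Continuous fun τ => μ (φ τ z) := hμ.comp_continuous hγ fun τ => hφmem τ z hz
  have hA : Continuous fun τ => fderiv ℝ V (φ τ z) :=
    (hV.continuousOn_fderiv_of_isOpen hΩ (by simp)).comp_continuous hγ fun τ => hφmem τ z hz
  refine eq_of_hasDerivAt_clm_apply (t₀ := 0) hA
    (f := fun t => fderiv ℝ (fun p : ℝ × E => φ p.1 p.2) (t, z) (0, W z))
    (g := fun t => W (φ t z) - (∫ τ in (0 : ℝ)..t, μ (φ τ z)) • V (φ t z))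
    (hasDerivAt_fderiv_flow hΩ hV hφmem hφ hφode hz (W z)) ?_ ?_ ht
  · intro τ
    have hd : ∀ {X : E → E}, ContDiffOn ℝ (⊤ : ℕ∞) X Ω →
        HasDerivAt (fun τ => X (φ τ z)) (fderiv ℝ X (φ τ z) (V (φ τ z))) τ := fun hX =>
      ((hX.contDiffAt (hΩ.mem_nhds (hφmem τ z hz))).differentiableAt
        (by simp)).hasFDerivAt.comp_hasDerivAt τ (hφode τ z hz)
    refine ((hd hW).sub
      ((hμγ.integral_hasStrictDerivAt 0 τ).hasDerivAt.smul (hd hV))).congr_deriv ?_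
    rw [map_sub, map_smul, ← hbracket _ (hφmem τ z hz)]
    abel
  · have h1 := (hasFDerivAt_flow hΩ hφ hz 0).comp z ((hasFDerivAt_const (0 : ℝ) z).prodMk (hasFDerivAt_id z))
    have h2 := (hasFDerivAt_id (𝕜 := ℝ) z).congr_of_eventuallyEq
      (eventually_of_mem (hΩ.mem_nhds hz) hφ0 : (fun y => φ 0 y) =ᶠ[𝓝 z] id)
    have h3 := congrArg (fun L : E →L[ℝ] E => L (W z)) (h1.unique h2)
    simpa [hφ0 z hz] using h3

end Flow

section Period

variable {E : Type*} [NormedAddCommGroup E] [NormedSpace ℝ E] {Ω : Set E} {V W : E → E}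
  {μ : E → ℝ} {φ : ℝ → E → E} {z : ℝ → E} {T : ℝ → ℝ}

/-- The derivative of the period along `W` is the integral of `μ` over the cycle. -/
theorem deriv_period_eq_integral (hΩ : IsOpen Ω) (hV : ContDiffOn ℝ (⊤ : ℕ∞) V Ω)
    (hW : ContDiffOn ℝ (⊤ : ℕ∞) W Ω) (hμ : ContinuousOn μ Ω) (hV0 : ∀ z ∈ Ω, V z ≠ 0)
    (hbracket : ∀ z ∈ Ω, fderiv ℝ W z (V z) - fderiv ℝ V z (W z) = μ z • V z)
    (hφmem : ∀ t, ∀ z ∈ Ω, φ t z ∈ Ω)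
    (hφ : ContDiffOn ℝ (⊤ : ℕ∞) (fun p : ℝ × E => φ p.1 p.2) (univ ×ˢ Ω))
    (hφ0 : ∀ z ∈ Ω, φ 0 z = z)
    (hφode : ∀ t, ∀ z ∈ Ω, HasDerivAt (fun τ => φ τ z) (V (φ t z)) t)
    (hz : ∀ s, z s ∈ Ω) (hzode : ∀ s, HasDerivAt z (W (z s)) s)
    (hT : Differentiable ℝ T) (hT0 : ∀ s, 0 ≤ T s) (hper : ∀ s, φ (T s) (z s) = z s) (s : ℝ) :
    deriv T s = ∫ t in (0 : ℝ)..T s, μ (φ t (z s)) := by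
  have hF := hasFDerivAt_flow hΩ hφ (hz s) (T s)
  have h : HasDerivAt (fun σ => φ (T σ) (z σ))
      (fderiv ℝ (fun p : ℝ × E => φ p.1 p.2) (T s, z s) (deriv T s, W (z s))) s :=
    HasFDerivAt.comp_hasDerivAt (f := fun σ => (T σ, z σ)) s hF
      ((hT s).hasDerivAt.prodMk (hzode s))
  have h1 := h.unique ((hzode s).congr_of_eventuallyEq (Eventually.of_forall hper))
  rw [fderiv_flow_apply_eq_of_bracket hΩ hV hW hμ hbracket hφmem hφ hφ0 hφode (hz s) (hT0 s),
    hper s] at h1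
  have h2 : (deriv T s - ∫ t in (0 : ℝ)..T s, μ (φ t (z s))) • V (z s) = 0 := by
    rw [sub_smul, ← sub_eq_zero.2 h1]
    abel
  exact sub_eq_zero.1 ((smul_eq_zero.1 h2).resolve_right (hV0 _ (hz s)))

/-- The second derivative of the period along `W` is the integral of `μ² + ∂_W μ` over the
cycle. -/
theorem iteratedDeriv_two_period_eq_integral (hΩ : IsOpen Ω) (hV : ContDiffOn ℝ (⊤ : ℕ∞) V Ω)
    (hW : ContDiffOn ℝ (⊤ : ℕ∞) W Ω) (hμ : ContDiffOn ℝ (⊤ : ℕ∞) μ Ω)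
    (hV0 : ∀ z ∈ Ω, V z ≠ 0)
    (hbracket : ∀ z ∈ Ω, fderiv ℝ W z (V z) - fderiv ℝ V z (W z) = μ z • V z)
    (hφmem : ∀ t, ∀ z ∈ Ω, φ t z ∈ Ω)
    (hφ : ContDiffOn ℝ (⊤ : ℕ∞) (fun p : ℝ × E => φ p.1 p.2) (univ ×ˢ Ω))
    (hφ0 : ∀ z ∈ Ω, φ 0 z = z)
    (hφode : ∀ t, ∀ z ∈ Ω, HasDerivAt (fun τ => φ τ z) (V (φ t z)) t)
    (hz : ∀ s, z s ∈ Ω) (hzode : ∀ s, HasDerivAt z (W (z s)) s)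
    (hT : ContDiff ℝ (⊤ : ℕ∞) T) (hT0 : ∀ s, 0 ≤ T s) (hper : ∀ s, φ (T s) (z s) = z s)
    (s : ℝ) :
    iteratedDeriv 2 T s =
      ∫ t in (0 : ℝ)..T s, (μ (φ t (z s)) ^ 2 + fderiv ℝ μ (φ t (z s)) (W (φ t (z s)))) := by
  have hTd : Differentiable ℝ T := hT.differentiable (by simp)
  have hT'c : Continuous (deriv T) := hT.continuous_deriv (by simp)
  have hzc : Continuous z := continuous_iff_continuousAt.2 fun s => (hzode s).continuousAt
  have hWc : Continuous fun s => W (z s) := hW.continuousOn.comp_continuous hzc hz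
  have hpc : Continuous fun p : ℝ × ℝ => (p.2 * T p.1, z p.1) := by
    have := hTd.continuous
    fun_prop
  have hp : ∀ p : ℝ × ℝ, (p.2 * T p.1, z p.1) ∈ (univ ×ˢ Ω : Set (ℝ × E)) := fun p =>
    ⟨mem_univ _, hz p.1⟩
  have hφc : Continuous fun p : ℝ × ℝ => φ (p.2 * T p.1) (z p.1) :=
    hφ.continuousOn.comp_continuous hpc hp
  have hDφc : Continuous fun p : ℝ × ℝ =>
      fderiv ℝ (fun p : ℝ × E => φ p.1 p.2) (p.2 * T p.1, z p.1) :=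
    (hφ.continuousOn_fderiv_of_isOpen (isOpen_univ.prod hΩ) (by simp)).comp_continuous hpc hp
  have hμd : ∀ y ∈ Ω, HasFDerivAt μ (fderiv ℝ μ y) y := fun y hy =>
    ((hμ.contDiffAt (hΩ.mem_nhds hy)).differentiableAt (by simp)).hasFDerivAt
  have hDμ : ContinuousOn (fderiv ℝ μ) Ω := hμ.continuousOn_fderiv_of_isOpen hΩ (by simp)
  have hμc : Continuous fun p : ℝ × ℝ => μ (φ (p.2 * T p.1) (z p.1)) :=
    hμ.continuousOn.comp_continuous hφc fun p => hφmem _ _ (hz _)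
  have hDμc : Continuous fun p : ℝ × ℝ => fderiv ℝ μ (φ (p.2 * T p.1) (z p.1)) :=
    hDμ.comp_continuous hφc fun p => hφmem _ _ (hz _)
  let g : ℝ → ℝ → ℝ := fun s u => T s * μ (φ (u * T s) (z s))
  let g' : ℝ → ℝ → ℝ := fun s u => deriv T s * μ (φ (u * T s) (z s)) +
    T s * fderiv ℝ μ (φ (u * T s) (z s)) (fderiv ℝ (fun p : ℝ × E => φ p.1 p.2)
      (u * T s, z s) (u * deriv T s, W (z s)))
  have hg : Continuous fun p : ℝ × ℝ => g p.1 p.2 := (hTd.continuous.comp continuous_fst).mul hμc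
  have hg' : Continuous fun p : ℝ × ℝ => g' p.1 p.2 :=
    ((hT'c.comp continuous_fst).mul hμc).add ((hTd.continuous.comp continuous_fst).mul
      (hDμc.clm_apply (hDφc.clm_apply
        ((continuous_snd.mul (hT'c.comp continuous_fst)).prodMk (hWc.comp continuous_fst)))))
  have hd : ∀ s u, HasDerivAt (fun σ => g σ u) (g' s u) s := by
    intro s u
    have h1 : HasDerivAt (fun σ => φ (u * T σ) (z σ)) (fderiv ℝ (fun p : ℝ × E => φ p.1 p.2)
        (u * T s, z s) (u * deriv T s, W (z s))) s :=
      HasFDerivAt.comp_hasDerivAt (f := fun σ => (u * T σ, z σ)) s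
        (hasFDerivAt_flow hΩ hφ (hz s) (u * T s))
        (((hTd s).hasDerivAt.const_mul u).prodMk (hzode s))
    exact (hTd s).hasDerivAt.mul
      (HasFDerivAt.comp_hasDerivAt (f := fun σ => φ (u * T σ) (z σ)) s
        (hμd _ (hφmem _ _ (hz s))) h1)
  have hT' : deriv T = fun σ => ∫ u in (0 : ℝ)..1, g σ u := by
    funext σ
    rw [deriv_period_eq_integral hΩ hV hW hμ.continuousOn hV0 hbracket hφmem hφ hφ0 hφode hz
      hzode hTd hT0 hper σ, intervalIntegral.integral_const_mul,
      intervalIntegral.mul_integral_comp_mul_right (f := fun t => μ (φ t (z σ)))]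
    simp
  have hT'' : iteratedDeriv 2 T s = ∫ u in (0 : ℝ)..1, g' s u := by
    rw [iteratedDeriv_succ, iteratedDeriv_one, hT']
    exact (hasDerivAt_intervalIntegral_of_continuous_deriv
      (fun σ => hg.comp (by fun_prop : Continuous fun u : ℝ => (σ, u))) hg' hd s).deriv
  let h : ℝ → ℝ := fun t => μ (φ t (z s)) ^ 2 + fderiv ℝ μ (φ t (z s)) (W (φ t (z s)))
  have hγ : Continuous fun t => φ t (z s) :=
    continuous_iff_continuousAt.2 fun t => (hφode t _ (hz s)).continuousAt
  have hμγ : Continuous fun t => μ (φ t (z s)) :=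
    hμ.continuousOn.comp_continuous hγ fun t => hφmem t _ (hz s)
  have hh : Continuous h := (hμγ.pow 2).add
    ((hDμ.comp_continuous hγ fun t => hφmem t _ (hz s)).clm_apply
      (hW.continuousOn.comp_continuous hγ fun t => hφmem t _ (hz s)))
  have hg's : Continuous (g' s) := hg'.comp (by fun_prop : Continuous fun u : ℝ => (s, u))
  have hhT : Continuous fun u => T s * h (u * T s) := by fun_prop
  -- `g' - T h` is the derivative in `u` of a function vanishing at both endpoints.
  have hQ : ∀ u ∈ uIcc (0 : ℝ) 1, HasDerivAt
      (fun u => (u * deriv T s - ∫ t in (0 : ℝ)..u * T s, μ (φ t (z s))) * μ (φ (u * T s) (z s)))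
      (g' s u - T s * h (u * T s)) u := by
    intro u hu
    rw [uIcc_of_le zero_le_one] at hu
    have hlin : ∀ c : ℝ, HasDerivAt (fun u : ℝ => u * c) c u := fun c => by
      simpa using (hasDerivAt_id u).mul_const c
    have hM : HasDerivAt (fun u => ∫ t in (0 : ℝ)..u * T s, μ (φ t (z s)))
        (μ (φ (u * T s) (z s)) * T s) u :=
      HasDerivAt.comp (h₂ := fun x => ∫ t in (0 : ℝ)..x, μ (φ t (z s))) u
        (hμγ.integral_hasStrictDerivAt 0 (u * T s)).hasDerivAt (hlin (T s))
    have hμu : HasDerivAt (fun u => μ (φ (u * T s) (z s)))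
        (fderiv ℝ μ (φ (u * T s) (z s)) (V (φ (u * T s) (z s))) * T s) u :=
      HasDerivAt.comp (h₂ := fun t => μ (φ t (z s))) u
        (HasFDerivAt.comp_hasDerivAt (f := fun t => φ t (z s)) (u * T s)
          (hμd _ (hφmem _ _ (hz s))) (hφode _ _ (hz s))) (hlin (T s))
    refine (((hlin (deriv T s)).sub hM).mul hμu).congr_deriv ?_
    simp only [g', h]
    rw [fderiv_flow_apply_eq_of_bracket hΩ hV hW hμ.continuousOn hbracket hφmem hφ hφ0 hφode
      (hz s) (mul_nonneg hu.1 (hT0 s))]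
    simp only [map_add, map_sub, map_smul, smul_eq_mul, Pi.sub_apply]
    ring
  have hQint := intervalIntegral.integral_eq_sub_of_hasDerivAt hQ
    ((hg's.sub hhT).intervalIntegrable _ _)
  rw [intervalIntegral.integral_sub (hg's.intervalIntegrable _ _) (hhT.intervalIntegrable _ _),
    one_mul, one_mul, deriv_period_eq_integral hΩ hV hW hμ.continuousOn hV0 hbracket hφmem hφ hφ0
      hφode hz hzode hTd hT0 hper s, intervalIntegral.integral_const_mul,
    intervalIntegral.mul_integral_comp_mul_right] at hQint
  rw [hT'']
  simpa [sub_eq_zero] using hQint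

end Period

/-- if `∂_W μ ≥ 0` on `Ω` then the period function is `W`-convex
(`T'' ≥ 0`); if moreover every cycle carries a point where `μ² + ∂_W μ > 0`,
then `T'' > 0` everywhere. -/
theorem period_convexity
    (Ω : Set (ℝ × ℝ)) (hΩ : IsOpen Ω)
    (V W : ℝ × ℝ → ℝ × ℝ) (μ : ℝ × ℝ → ℝ)
    (hV : ContDiffOn ℝ (⊤ : ℕ∞) V Ω) (hW : ContDiffOn ℝ (⊤ : ℕ∞) W Ω)
    (hμ : ContDiffOn ℝ (⊤ : ℕ∞) μ Ω)
    (hind : ∀ z ∈ Ω, LinearIndependent ℝ ![V z, W z])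
    (hbracket : ∀ z ∈ Ω,
      fderiv ℝ W z (V z) - fderiv ℝ V z (W z) = μ z • V z)
    (φV : ℝ → ℝ × ℝ → ℝ × ℝ)
    (hφmem : ∀ t : ℝ, ∀ z ∈ Ω, φV t z ∈ Ω)
    (hφsmooth : ContDiffOn ℝ (⊤ : ℕ∞)
      (fun p : ℝ × (ℝ × ℝ) => φV p.1 p.2) (Set.univ ×ˢ Ω))
    (hφ0 : ∀ z ∈ Ω, φV 0 z = z)
    (hφode : ∀ t : ℝ, ∀ z ∈ Ω, HasDerivAt (fun τ => φV τ z) (V (φV t z)) t)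
    (z : ℝ → ℝ × ℝ) (hz : ∀ s, z s ∈ Ω)
    (hzode : ∀ s, HasDerivAt z (W (z s)) s)
    (T : ℝ → ℝ) (hT : ContDiff ℝ (⊤ : ℕ∞) T) (hTpos : ∀ s, 0 < T s)
    (hper : ∀ s, φV (T s) (z s) = z s)
    (hWμ : ∀ z ∈ Ω, 0 ≤ fderiv ℝ μ z (W z)) :
    (∀ s, 0 ≤ iteratedDeriv 2 T s)
    ∧
    ((∀ s, ∃ t ∈ Set.Icc (0:ℝ) (T s),
        0 < μ (φV t (z s)) ^ 2 + fderiv ℝ μ (φV t (z s)) (W (φV t (z s)))) →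
      ∀ s, 0 < iteratedDeriv 2 T s) := by
  have hV0 : ∀ z ∈ Ω, V z ≠ 0 := fun z hz' => (hind z hz').ne_zero 0
  have hT'' := iteratedDeriv_two_period_eq_integral hΩ hV hW hμ hV0 hbracket hφmem hφsmooth hφ0
    hφode hz hzode hT (fun s => (hTpos s).le) hper
  have hnonneg : ∀ s t, 0 ≤ μ (φV t (z s)) ^ 2 +
      fderiv ℝ μ (φV t (z s)) (W (φV t (z s))) := fun s t =>
    add_nonneg (sq_nonneg _) (hWμ _ (hφmem t _ (hz s)))
  refine ⟨fun s => ?_, fun hpos s => ?_⟩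
  · rw [hT'']
    exact intervalIntegral.integral_nonneg (hTpos s).le fun t _ => hnonneg s t
  · rw [hT'']
    have hγ : Continuous fun t => φV t (z s) :=
      continuous_iff_continuousAt.2 fun t => (hφode t _ (hz s)).continuousAt
    have hmem : ∀ t, φV t (z s) ∈ Ω := fun t => hφmem t _ (hz s)
    refine intervalIntegral.integral_pos (hTpos s) (Continuous.continuousOn ?_)
      (fun t _ => hnonneg s t) (hpos s)
    exact ((hμ.continuousOn.comp_continuous hγ hmem).pow 2).add
      (((hμ.continuousOn_fderiv_of_isOpen hΩ (by simp)).comp_continuous hγ hmem).clm_apply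
        (hW.continuousOn.comp_continuous hγ hmem))
end

section
/- Let Ω ⊆ ℝ² be open, V, W : Ω → ℝ² be C^∞ vector fields that are linearly independent at every point of Ω, and μ : Ω → ℝ be C^∞ with [V,W] = μ·V on Ω. Define μ_1 = μ and μ_{j+1} = μ_j·μ + ∂_W μ_j. Let φ_V : ℝ × Ω → Ω be a C^∞ flow of V, let z : ℝ → Ω satisfy z'(s) = W(z(s)), and let T : ℝ → ℝ be C^∞ with T(s) > 0 and φ_V(T(s), z(s)) = z(s) for all s. If for some n ≥ 1 one has μ_n ≥ 0 on Ω and for every s there exists t ∈ [0, T(s)] with μ_n(φ_V(t, z(s))) > 0, then the n-th derivative of T is strictly positive everywhere; consequently the set {s ∈ ℝ : T'(s) = 0} has at most n − 1 elements. -/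
open Set Filter Topology MeasureTheory

/-- A smooth function whose `m`-th derivative vanishes nowhere has at most `m` zeros. -/
theorem card_le_of_iteratedDeriv_ne_zero (m : ℕ) :
    ∀ (f : ℝ → ℝ), ContDiff ℝ (⊤ : ℕ∞) f → (∀ s, iteratedDeriv m f s ≠ 0) →
      ∀ S : Finset ℝ, (∀ s ∈ S, f s = 0) → S.card ≤ m := by
  induction m with
  | zero =>
    intro f _ hne S hS
    rw [Nat.le_zero, Finset.card_eq_zero, Finset.eq_empty_iff_forall_notMem]
    intro s hs
    exact hne s (by simpa using hS s hs)
  | succ m ih =>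
    intro f hf hne S hS
    have hd := ih (deriv f) (contDiff_infty_iff_deriv.1 hf).2
      (fun s => by rw [← iteratedDeriv_succ']; exact hne s)
    have hfin : {s | deriv f s = 0}.Finite := by
      by_contra hinf
      obtain ⟨F, hF, hcard⟩ := Set.Infinite.exists_subset_card_eq hinf (m + 1)
      have := hd F (fun s hs => hF hs)
      omega
    have hZ : hfin.toFinset.card ≤ m := hd _ (fun s hs => by simpa using hs)
    refine (Finset.card_le_of_interleaved (t := hfin.toFinset) ?_).trans (Nat.succ_le_succ hZ)
    intro x hx y hy hxy _
    obtain ⟨c, hc, hc0⟩ := exists_deriv_eq_zero hxy hf.continuous.continuousOn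
      ((hS x hx).trans (hS y hy).symm)
    exact ⟨c, by simpa using hc0, hc.1, hc.2⟩

/-- Differentiation under the integral sign for a `C¹` integrand. -/
theorem hasDerivAt_intervalIntegral_of_contDiff {g : ℝ × ℝ → ℝ} (hg : ContDiff ℝ 1 g)
    (a b s : ℝ) :
    HasDerivAt (fun s => ∫ u in a..b, g (u, s)) (∫ u in a..b, fderiv ℝ g (u, s) (0, 1)) s := by
  have hc : Continuous fun p => fderiv ℝ g p (0, 1) :=
    (hg.continuous_fderiv one_ne_zero).clm_apply continuous_const
  obtain ⟨C, hC⟩ := ((isCompact_uIcc (a := a) (b := b)).prod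
    (isCompact_Icc (a := s - 1) (b := s + 1))).exists_bound_of_continuousOn hc.continuousOn
  refine (intervalIntegral.hasDerivAt_integral_of_dominated_loc_of_deriv_le
    (F := fun s u => g (u, s)) (F' := fun s u => fderiv ℝ g (u, s) (0, 1))
    (s := Icc (s - 1) (s + 1)) (bound := fun _ => C)
    (Icc_mem_nhds (by linarith) (by linarith)) ?_ ?_ ?_ ?_ ?_ ?_).2
  · exact Eventually.of_forall fun r =>
      (hg.continuous.comp (by fun_prop : Continuous fun u : ℝ => (u, r))).aestronglyMeasurable
  · exact (hg.continuous.comp (by fun_prop : Continuous fun u : ℝ => (u, s))).intervalIntegrable _ _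
  · exact (hc.comp (by fun_prop : Continuous fun u : ℝ => (u, s))).aestronglyMeasurable
  · exact Eventually.of_forall fun u hu r hr => hC (u, r) ⟨uIoc_subset_uIcc hu, hr⟩
  · simp
  · refine Eventually.of_forall fun u _ r _ => ?_
    exact (hg.differentiable one_ne_zero (u, r)).hasFDerivAt.comp_hasDerivAt r
      ((hasDerivAt_const r u).prodMk (hasDerivAt_id r))

/-- The only solution of a linear equation `y' = L(t) y` vanishing at `0` is zero. -/
theorem eq_zero_of_hasDerivAt_clm {E : Type*} [NormedAddCommGroup E] [NormedSpace ℝ E]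
    {L : ℝ → E →L[ℝ] E} (hL : Continuous L) {y : ℝ → E}
    (hy : ∀ t, HasDerivAt y (L t (y t)) t) (hy0 : y 0 = 0) {t : ℝ} (ht : 0 ≤ t) : y t = 0 := by
  obtain ⟨K, hK⟩ := (isCompact_Icc (a := (0 : ℝ)) (b := t)).exists_bound_of_continuousOn
    hL.continuousOn
  refine eq_zero_of_abs_deriv_le_mul_abs_self_of_eq_zero_right (K := K)
    (fun r _ => (hy r).continuousAt.continuousWithinAt)
    (fun r _ => (hy r).hasDerivWithinAt) hy0 (fun r hr => ?_) t (right_mem_Icc.2 ht)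
  exact (L r).le_of_opNorm_le (hK r (Ico_subset_Icc_self hr)) _

/-- Integral curves of a smooth vector field are smooth. -/
theorem contDiff_of_integralCurve {E : Type*} [NormedAddCommGroup E] [NormedSpace ℝ E]
    {Ω : Set E} {W : E → E} (hW : ContDiffOn ℝ (⊤ : ℕ∞) W Ω) {z : ℝ → E} (hz : ∀ s, z s ∈ Ω)
    (hzode : ∀ s, HasDerivAt z (W (z s)) s) (k : ℕ) : ContDiff ℝ k z := by
  induction k with
  | zero =>
    exact contDiff_zero.2 (continuous_iff_continuousAt.2 fun s => (hzode s).continuousAt)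
  | succ k ih =>
    have hd : deriv z = W ∘ z := funext fun s => (hzode s).deriv
    rw [Nat.cast_succ, contDiff_succ_iff_deriv, hd]
    exact ⟨fun s => (hzode s).differentiableAt, by simp,
      (hW.of_le (by exact_mod_cast le_top)).comp_contDiff ih hz⟩

section Variation

variable {Ω : Set (ℝ × ℝ)} {V W : ℝ × ℝ → ℝ × ℝ} {μ : ℝ × ℝ → ℝ} {X : ℝ × ℝ → ℝ × ℝ}

theorem hasDerivAt_integral_comp (hμ : ContinuousOn μ Ω) (hX : Continuous X)
    (hXmem : ∀ p, X p ∈ Ω) (t s : ℝ) :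
    HasDerivAt (fun t => ∫ τ in (0 : ℝ)..t, μ (X (τ, s))) (μ (X (t, s))) t := by
  have hc : Continuous fun τ => μ (X (τ, s)) :=
    hμ.comp_continuous (hX.comp (by fun_prop)) fun _ => hXmem _
  exact intervalIntegral.integral_hasDerivAt_right (hc.intervalIntegrable _ _)
    (hc.stronglyMeasurableAtFilter _ _) hc.continuousAt

/-- The variation of the flow lines of `V` along an integral curve of `W`, when
`[V, W] = μ • V`. -/
theorem fderiv_flow_transversal (hΩ : IsOpen Ω) (hV : ContDiffOn ℝ (⊤ : ℕ∞) V Ω)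
    (hW : ContDiffOn ℝ (⊤ : ℕ∞) W Ω) (hμ : ContinuousOn μ Ω)
    (hbracket : ∀ z ∈ Ω, fderiv ℝ W z (V z) - fderiv ℝ V z (W z) = μ z • V z)
    (hX : ContDiff ℝ 2 X) (hXmem : ∀ p, X p ∈ Ω)
    (hXt : ∀ p, fderiv ℝ X p (1, 0) = V (X p))
    (hX0 : ∀ s, fderiv ℝ X (0, s) (0, 1) = W (X (0, s))) {t : ℝ} (ht : 0 ≤ t) (s : ℝ) :
    fderiv ℝ X (t, s) (0, 1) =
      W (X (t, s)) - (∫ τ in (0 : ℝ)..t, μ (X (τ, s))) • V (X (t, s)) := by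
  have hVd : ∀ p, DifferentiableAt ℝ V (X p) := fun p =>
    (hV.contDiffAt (hΩ.mem_nhds (hXmem p))).differentiableAt (by simp)
  have hWd : ∀ p, DifferentiableAt ℝ W (X p) := fun p =>
    (hW.contDiffAt (hΩ.mem_nhds (hXmem p))).differentiableAt (by simp)
  have hXd : ∀ p, DifferentiableAt ℝ X p := hX.differentiable two_ne_zero
  have hX1 : Differentiable ℝ (fderiv ℝ X) :=
    (hX.fderiv_right (m := 1) (by norm_num)).differentiable one_ne_zero
  have hline : ∀ t : ℝ, HasDerivAt (fun t : ℝ => (t, s)) ((1 : ℝ), (0 : ℝ)) t := fun t =>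
    (hasDerivAt_id t).prodMk (hasDerivAt_const t s)
  have hXline : ∀ t : ℝ, HasDerivAt (fun t : ℝ => X (t, s)) (V (X (t, s))) t := fun t => by
    rw [← hXt]
    exact (hXd (t, s)).hasFDerivAt.comp_hasDerivAt t (hline t)
  have hmixed : ∀ t : ℝ, HasDerivAt (fun t : ℝ => fderiv ℝ X (t, s) (0, 1))
      (fderiv ℝ V (X (t, s)) (fderiv ℝ X (t, s) (0, 1))) t := fun t => by
    have h0 : HasDerivAt (fun t : ℝ => fderiv ℝ X (t, s))
        (fderiv ℝ (fderiv ℝ X) (t, s) (1, 0)) t :=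
      (hX1 (t, s)).hasFDerivAt.comp_hasDerivAt t (hline t)
    have h1 := h0.clm_apply (hasDerivAt_const t ((0 : ℝ), (1 : ℝ)))
    have hsymm : fderiv ℝ (fderiv ℝ X) (t, s) (1, 0) (0, 1) =
        fderiv ℝ (fderiv ℝ X) (t, s) (0, 1) (1, 0) :=
      hX.contDiffAt.isSymmSndFDerivAt (by simp) _ _
    have h2 : HasFDerivAt (fun p => fderiv ℝ X p (1, 0))
        ((fderiv ℝ V (X (t, s))).comp (fderiv ℝ X (t, s))) (t, s) := by
      simp only [hXt]
      exact (hVd _).hasFDerivAt.comp _ (hXd _).hasFDerivAt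
    have h3 := ((hX1 (t, s)).hasFDerivAt.clm_apply
      (hasFDerivAt_const ((1 : ℝ), (0 : ℝ)) (t, s))).unique h2
    have h4 := DFunLike.congr_fun h3 ((0 : ℝ), (1 : ℝ))
    simp at h4
    simpa [hsymm, h4] using h1
  rw [← sub_eq_zero]
  refine eq_zero_of_hasDerivAt_clm (L := fun t => fderiv ℝ V (X (t, s)))
    (y := fun t => fderiv ℝ X (t, s) (0, 1) -
      (W (X (t, s)) - (∫ τ in (0 : ℝ)..t, μ (X (τ, s))) • V (X (t, s)))) ?_ (fun t => ?_) ?_ ht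
  · exact (hV.continuousOn_fderiv_of_isOpen hΩ (by simp)).comp_continuous
      (hX.continuous.comp (by fun_prop)) fun _ => hXmem _
  · have h := (hmixed t).sub (((hWd _).hasFDerivAt.comp_hasDerivAt t (hXline t)).sub
      ((hasDerivAt_integral_comp hμ hX.continuous hXmem t s).smul
        ((hVd _).hasFDerivAt.comp_hasDerivAt t (hXline t))))
    refine h.congr_deriv ?_
    have hb := hbracket _ (hXmem (t, s))
    rw [sub_eq_iff_eq_add] at hb
    simp only [map_sub, map_smul, hb, Function.comp_apply]
    abel
  · simp [hX0]

/-- Derivative along the family of the integral of a function over the cycles. -/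
theorem hasDerivAt_integral_cycle (hΩ : IsOpen Ω) (hV : ContinuousOn V Ω)
    (hW : ContinuousOn W Ω) (hμ : ContinuousOn μ Ω) (hX : ContDiff ℝ 1 X)
    (hXmem : ∀ p, X p ∈ Ω) (hXt : ∀ p, fderiv ℝ X p (1, 0) = V (X p))
    (hXs : ∀ t s : ℝ, 0 ≤ t → fderiv ℝ X (t, s) (0, 1) =
      W (X (t, s)) - (∫ τ in (0 : ℝ)..t, μ (X (τ, s))) • V (X (t, s)))
    {T : ℝ → ℝ} (hT : ContDiff ℝ 1 T) (hTpos : ∀ s, 0 < T s)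
    (hTder : ∀ s, deriv T s = ∫ τ in (0 : ℝ)..T s, μ (X (τ, s)))
    {f : ℝ × ℝ → ℝ} (hf : ContDiffOn ℝ 1 f Ω) (s : ℝ) :
    HasDerivAt (fun s => ∫ t in (0 : ℝ)..T s, f (X (t, s)))
      (∫ t in (0 : ℝ)..T s,
        (f (X (t, s)) * μ (X (t, s)) + fderiv ℝ f (X (t, s)) (W (X (t, s))))) s := by
  have hscale : ∀ (h : ℝ → ℝ) (r : ℝ),
      ∫ t in (0 : ℝ)..T r, h t = ∫ u in (0 : ℝ)..1, T r * h (T r * u) := fun h r => by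
    rw [intervalIntegral.integral_const_mul, intervalIntegral.mul_integral_comp_mul_left]
    simp
  have hfd : ∀ p, DifferentiableAt ℝ f (X p) := fun p =>
    (hf.contDiffAt (hΩ.mem_nhds (hXmem p))).differentiableAt one_ne_zero
  have hXd : ∀ p, DifferentiableAt ℝ X p := hX.differentiable one_ne_zero
  have hg : ContDiff ℝ 1 fun p : ℝ × ℝ => T p.2 * f (X (T p.2 * p.1, p.2)) := by
    refine (hT.comp contDiff_snd).mul (hf.comp_contDiff (hX.comp ?_) fun _ => hXmem _)
    exact ((hT.comp contDiff_snd).mul contDiff_fst).prodMk contDiff_snd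
  have hderiv := hasDerivAt_intervalIntegral_of_contDiff hg 0 1 s
  simp only [hscale]
  refine hderiv.congr_deriv ?_
  have hXu : Continuous fun u : ℝ => X (T s * u, s) := hX.continuous.comp (by fun_prop)
  have cμ : Continuous fun u : ℝ => μ (X (T s * u, s)) := hμ.comp_continuous hXu fun _ => hXmem _
  have cf : Continuous fun u : ℝ => f (X (T s * u, s)) :=
    hf.continuousOn.comp_continuous hXu fun _ => hXmem _
  have cD : Continuous fun u : ℝ => fderiv ℝ f (X (T s * u, s)) :=
    (hf.continuousOn_fderiv_of_isOpen hΩ le_rfl).comp_continuous hXu fun _ => hXmem _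
  have cV : Continuous fun u : ℝ => V (X (T s * u, s)) := hV.comp_continuous hXu fun _ => hXmem _
  have cW : Continuous fun u : ℝ => W (X (T s * u, s)) := hW.comp_continuous hXu fun _ => hXmem _
  set A : ℝ → ℝ := fun t => ∫ τ in (0 : ℝ)..t, μ (X (τ, s)) with hA
  have hlin : ∀ u : ℝ, HasDerivAt (fun u => T s * u) (T s) u := fun u => by
    simpa using (hasDerivAt_id u).const_mul (T s)
  have hAd : ∀ u, HasDerivAt (fun u => A (T s * u)) (μ (X (T s * u, s)) * T s) u := fun u =>
    (hasDerivAt_integral_comp hμ hX.continuous hXmem (T s * u) s).comp u (hlin u)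
  have cA : Continuous fun u => A (T s * u) :=
    continuous_iff_continuousAt.2 fun u => (hAd u).continuousAt
  -- the integrand differs from the expected one by an exact derivative in `u`
  set k' : ℝ → ℝ := fun u => (deriv T s - μ (X (T s * u, s)) * T s) * f (X (T s * u, s)) +
    (deriv T s * u - A (T s * u)) * (T s * fderiv ℝ f (X (T s * u, s)) (V (X (T s * u, s))))
    with hk'
  have hk : ∀ u, HasDerivAt
      (fun u => (deriv T s * u - A (T s * u)) * f (X (T s * u, s))) (k' u) u := fun u => by
    have h1 : HasDerivAt (fun u => X (T s * u, s)) (T s • V (X (T s * u, s))) u := by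
      have := (hXd (T s * u, s)).hasFDerivAt.comp_hasDerivAt u
        ((hlin u).prodMk (hasDerivAt_const u s))
      have e : ((T s, 0) : ℝ × ℝ) = T s • (1, 0) := by simp
      rwa [e, map_smul, hXt] at this
    have h2 := (hfd (T s * u, s)).hasFDerivAt.comp_hasDerivAt u h1
    have h3 := ((((hasDerivAt_id u).const_mul (deriv T s))).sub (hAd u)).mul h2
    refine h3.congr_deriv ?_
    simp [hk']
  have cDV := cD.clm_apply cV
  have cDW := cD.clm_apply cW
  have ck' : Continuous k' :=
    ((continuous_const.sub (cμ.mul continuous_const)).mul cf).add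
      (((continuous_const.mul continuous_id).sub cA).mul (continuous_const.mul cDV))
  have hk0 : ∫ u in (0 : ℝ)..1, k' u = 0 := by
    rw [intervalIntegral.integral_eq_sub_of_hasDerivAt (fun u _ => hk u)
      (ck'.intervalIntegrable _ _)]
    simp [hA, hTder]
  have hsplit : ∀ u ∈ uIcc (0 : ℝ) 1,
      fderiv ℝ (fun p : ℝ × ℝ => T p.2 * f (X (T p.2 * p.1, p.2))) (u, s) (0, 1) =
        k' u + T s * (f (X (T s * u, s)) * μ (X (T s * u, s)) +
          fderiv ℝ f (X (T s * u, s)) (W (X (T s * u, s)))) := fun u hu => by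
    have hu0 : 0 ≤ u := by
      rw [uIcc_of_le zero_le_one] at hu
      exact hu.1
    have hl := (hg.differentiable one_ne_zero (u, s)).hasFDerivAt.comp_hasDerivAt s
      ((hasDerivAt_const s u).prodMk (hasDerivAt_id s))
    have hTd := (hT.differentiable one_ne_zero s).hasDerivAt
    have h1 := (hXd (T s * u, s)).hasFDerivAt.comp_hasDerivAt (f := fun r => (T r * u, r)) s
      ((hTd.mul_const u).prodMk (hasDerivAt_id s))
    have e : ((deriv T s * u, 1) : ℝ × ℝ) = (deriv T s * u) • (1, 0) + (0, 1) := by simp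
    rw [e, map_add, map_smul, hXt, hXs _ _ (mul_nonneg (hTpos s).le hu0)] at h1
    have h2 := hTd.mul ((hfd (T s * u, s)).hasFDerivAt.comp_hasDerivAt
      (f := fun r => X (T r * u, r)) s h1)
    refine (hl.unique h2).trans ?_
    simp [hk', hA]
    ring
  have cR : Continuous fun u => T s * (f (X (T s * u, s)) * μ (X (T s * u, s)) +
      fderiv ℝ f (X (T s * u, s)) (W (X (T s * u, s)))) :=
    continuous_const.mul ((cf.mul cμ).add cDW)
  rw [intervalIntegral.integral_congr hsplit, intervalIntegral.integral_add
    (ck'.intervalIntegrable _ _) (cR.intervalIntegrable _ _), hk0, zero_add]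

end Variation

/-- if `μ_n ≥ 0` on `Ω` and every cycle carries a point where
`μ_n > 0`, then the `n`-th derivative of `T` is strictly positive everywhere,
and the set of critical values `{s : T'(s) = 0}` has at most `n − 1` elements. -/
theorem at_most_n_minus_one_critical_cycles
    (Ω : Set (ℝ × ℝ)) (hΩ : IsOpen Ω)
    (V W : ℝ × ℝ → ℝ × ℝ) (μ : ℝ × ℝ → ℝ)
    (hV : ContDiffOn ℝ (⊤ : ℕ∞) V Ω) (hW : ContDiffOn ℝ (⊤ : ℕ∞) W Ω)
    (hμ : ContDiffOn ℝ (⊤ : ℕ∞) μ Ω)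
    (hind : ∀ z ∈ Ω, LinearIndependent ℝ ![V z, W z])
    (hbracket : ∀ z ∈ Ω,
      fderiv ℝ W z (V z) - fderiv ℝ V z (W z) = μ z • V z)
    (μseq : ℕ → ℝ × ℝ → ℝ)
    (hμ1 : ∀ z ∈ Ω, μseq 1 z = μ z)
    (hμrec : ∀ j : ℕ, 1 ≤ j → ∀ z ∈ Ω,
      μseq (j + 1) z = μseq j z * μ z + fderiv ℝ (μseq j) z (W z))
    (φV : ℝ → ℝ × ℝ → ℝ × ℝ)
    (hφmem : ∀ t : ℝ, ∀ z ∈ Ω, φV t z ∈ Ω)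
    (hφsmooth : ContDiffOn ℝ (⊤ : ℕ∞)
      (fun p : ℝ × (ℝ × ℝ) => φV p.1 p.2) (Set.univ ×ˢ Ω))
    (hφ0 : ∀ z ∈ Ω, φV 0 z = z)
    (hφode : ∀ t : ℝ, ∀ z ∈ Ω, HasDerivAt (fun τ => φV τ z) (V (φV t z)) t)
    (z : ℝ → ℝ × ℝ) (hz : ∀ s, z s ∈ Ω)
    (hzode : ∀ s, HasDerivAt z (W (z s)) s)
    (T : ℝ → ℝ) (hT : ContDiff ℝ (⊤ : ℕ∞) T) (hTpos : ∀ s, 0 < T s)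
    (hper : ∀ s, φV (T s) (z s) = z s)
    (n : ℕ) (hn : 1 ≤ n)
    (hμn : ∀ z ∈ Ω, 0 ≤ μseq n z)
    (hstrict : ∀ s, ∃ t ∈ Set.Icc (0:ℝ) (T s), 0 < μseq n (φV t (z s))) :
    (∀ s, 0 < iteratedDeriv n T s)
    ∧ {s : ℝ | deriv T s = 0}.Finite
    ∧ {s : ℝ | deriv T s = 0}.ncard ≤ n - 1 := by
  set X : ℝ × ℝ → ℝ × ℝ := fun p => φV p.1 (z p.2)
  have hXmem : ∀ p, X p ∈ Ω := fun p => hφmem _ _ (hz _)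
  have hX : ContDiff ℝ 2 X :=
    (hφsmooth.of_le (WithTop.coe_le_coe.2 (le_top : (2 : ℕ∞) ≤ ⊤))).comp_contDiff
      (contDiff_fst.prodMk ((contDiff_of_integralCurve hW hz hzode 2).comp contDiff_snd))
      fun p => ⟨mem_univ _, hz _⟩
  have hXd : ∀ p, HasFDerivAt X (fderiv ℝ X p) p := fun p =>
    (hX.differentiable two_ne_zero p).hasFDerivAt
  have hXt : ∀ p, fderiv ℝ X p (1, 0) = V (X p) := fun p =>
    ((hXd p).comp_hasDerivAt (f := fun t => (t, p.2)) p.1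
      ((hasDerivAt_id p.1).prodMk (hasDerivAt_const p.1 p.2))).unique (hφode p.1 _ (hz p.2))
  have hXcurve : ∀ t s, HasDerivAt (fun s => X (t, s)) (fderiv ℝ X (t, s) (0, 1)) s := fun t s =>
    (hXd (t, s)).comp_hasDerivAt s ((hasDerivAt_const s t).prodMk (hasDerivAt_id s))
  have hXzero : ∀ s, X (0, s) = z s := fun s => hφ0 _ (hz s)
  have hX0 : ∀ s, fderiv ℝ X (0, s) (0, 1) = W (X (0, s)) := fun s => by
    have h := hXcurve 0 s
    simp only [hXzero] at h ⊢
    exact h.unique (hzode s)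
  have hXs := fun (t s : ℝ) (ht : 0 ≤ t) =>
    fderiv_flow_transversal hΩ hV hW hμ.continuousOn hbracket hX hXmem hXt hX0 ht s
  have hTder : ∀ s, deriv T s = ∫ τ in (0 : ℝ)..T s, μ (X (τ, s)) := fun s => by
    have hTd := (hT.differentiable (by simp) s).hasDerivAt
    have h1 := (hXd (T s, s)).comp_hasDerivAt (f := fun s => (T s, s)) s
      (hTd.prodMk (hasDerivAt_id s))
    have hXT : ∀ s, X (T s, s) = z s := hper
    have h2 := h1.unique ((hzode s).congr_of_eventuallyEq (Eventually.of_forall hXT))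
    have e : ((deriv T s, 1) : ℝ × ℝ) = deriv T s • (1, 0) + (0, 1) := by simp
    rw [e, map_add, map_smul, hXt, hXs _ _ (hTpos s).le, hXT, add_sub_left_comm,
      add_eq_left, ← sub_smul, smul_eq_zero] at h2
    exact sub_eq_zero.1 (h2.resolve_right ((hind _ (hz s)).ne_zero 0))
  have hμs : ∀ j, ContDiffOn ℝ (⊤ : ℕ∞) (μseq (j + 1)) Ω := fun j => by
    induction j with
    | zero => exact hμ.congr hμ1
    | succ j ih =>
      refine ContDiffOn.congr ?_ (hμrec (j + 1) (by omega))
      exact (ih.mul hμ).add ((ih.fderiv_of_isOpen hΩ (by simp)).clm_apply hW)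
  have hiter : ∀ j s,
      iteratedDeriv (j + 1) T s = ∫ t in (0 : ℝ)..T s, μseq (j + 1) (X (t, s)) := fun j => by
    induction j with
    | zero =>
      intro s
      simp only [zero_add, iteratedDeriv_one, hTder, hμ1 _ (hXmem _)]
    | succ j ih =>
      intro s
      rw [iteratedDeriv_succ, funext ih, (hasDerivAt_integral_cycle hΩ hV.continuousOn
        hW.continuousOn hμ.continuousOn (hX.of_le (by norm_num)) hXmem hXt hXs
        (hT.of_le (by exact_mod_cast le_top)) hTpos hTder
        ((hμs j).of_le (by exact_mod_cast le_top)) s).deriv]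
      simp only [hμrec (j + 1) (by omega) _ (hXmem _)]
  obtain ⟨m, rfl⟩ : ∃ m, n = m + 1 := ⟨n - 1, by omega⟩
  have hpos : ∀ s, 0 < iteratedDeriv (m + 1) T s := fun s => by
    rw [hiter]
    exact intervalIntegral.integral_pos (hTpos s)
      ((hμs m).continuousOn.comp_continuous (hX.continuous.comp (by fun_prop))
        fun _ => hXmem _).continuousOn
      (fun t _ => hμn _ (hXmem _)) (hstrict s)
  have hcard := card_le_of_iteratedDeriv_ne_zero m (deriv T) (contDiff_infty_iff_deriv.1 hT).2
    (fun s => by rw [← iteratedDeriv_succ']; exact (hpos s).ne')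
  have hfin : {s : ℝ | deriv T s = 0}.Finite := by
    by_contra hinf
    obtain ⟨F, hF, hFcard⟩ := Set.Infinite.exists_subset_card_eq hinf (m + 1)
    have := hcard F fun s hs => hF hs
    omega
  refine ⟨hpos, hfin, ?_⟩
  rw [ncard_eq_toFinset_card _ hfin]
  exact hcard _ fun s hs => by simpa using hs
end

section
/- Let Ω ⊆ ℝ² be open and H : Ω → ℝ be C^∞ with ∇H(z) ≠ 0 for all z ∈ Ω. Let V = (H_y, −H_x) be the Hamiltonian vector field of H and let W = (H_x, H_y)/(H_x² + H_y²). Then [V, W] = μ_H·V on Ω, where μ_H = ((H_{yy} − H_{xx})H_x² − 4H_{xy}H_xH_y + (H_{xx} − H_{yy})H_y²)/(H_x² + H_y²)²; moreover ∂_W H = 1 on Ω. -/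
/-- Partial derivative of `H` with respect to `x`. -/
noncomputable def pdx (H : ℝ × ℝ → ℝ) (z : ℝ × ℝ) : ℝ := fderiv ℝ H z (1, 0)

/-- Partial derivative of `H` with respect to `y`. -/
noncomputable def pdy (H : ℝ × ℝ → ℝ) (z : ℝ × ℝ) : ℝ := fderiv ℝ H z (0, 1)

/-- Every linear functional on the plane is determined by its values on the standard basis. -/
theorem clm_prod_apply_eq (L : ℝ × ℝ →L[ℝ] ℝ) (s t : ℝ) :
    L (s, t) = s * L (1, 0) + t * L (0, 1) := by
  have h : ((s, t) : ℝ × ℝ) = s • ((1, 0) : ℝ × ℝ) + t • ((0, 1) : ℝ × ℝ) := by simp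
  rw [h, map_add, map_smul, map_smul, smul_eq_mul, smul_eq_mul]

theorem ContDiffAt.differentiableAt_fderiv_apply {H : ℝ × ℝ → ℝ} {z : ℝ × ℝ}
    (h : ContDiffAt ℝ 2 H z) (v : ℝ × ℝ) :
    DifferentiableAt ℝ (fun w ↦ fderiv ℝ H w v) z :=
  ((h.fderiv_right (m := 1) (by norm_num)).differentiableAt (by norm_num)).clm_apply
    (differentiableAt_const v)

/-- Mixed second partial derivatives of a `C²` function agree. -/
theorem ContDiffAt.pdx_pdy_eq {H : ℝ × ℝ → ℝ} {z : ℝ × ℝ} (h : ContDiffAt ℝ 2 H z) :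
    pdx (pdy H) z = pdy (pdx H) z := by
  have hd : DifferentiableAt ℝ (fderiv ℝ H) z :=
    (h.fderiv_right (m := 1) (by norm_num)).differentiableAt (by norm_num)
  have key (u v : ℝ × ℝ) :
      fderiv ℝ (fun w ↦ fderiv ℝ H w u) z v = fderiv ℝ (fderiv ℝ H) z v u := by
    rw [fderiv_clm_apply hd (differentiableAt_const u)]
    simp
  have hs := (h.isSymmSndFDerivAt (by simp)) (1, 0) (0, 1)
  exact (key _ _).trans (hs.trans (key _ _).symm)

/-- the vector field `W = ∇H/|∇H|²` normalizes the Hamiltonian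
field `V = (H_y, −H_x)` with N-cofactor
`μ_H = ((H_{yy} − H_{xx})H_x² − 4H_{xy}H_xH_y + (H_{xx} − H_{yy})H_y²)/|∇H|⁴`,
and moreover `∂_W H = 1`. -/
theorem hamiltonian_gradient_normalizer
    (Ω : Set (ℝ × ℝ)) (hΩ : IsOpen Ω)
    (H : ℝ × ℝ → ℝ) (hH : ContDiffOn ℝ (⊤ : ℕ∞) H Ω)
    (hgrad : ∀ z ∈ Ω, (pdx H z, pdy H z) ≠ (0, 0))
    (V W : ℝ × ℝ → ℝ × ℝ) (μH : ℝ × ℝ → ℝ)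
    (hV : ∀ z, V z = (pdy H z, -pdx H z))
    (hW : ∀ z, W z = (pdx H z / ((pdx H z) ^ 2 + (pdy H z) ^ 2),
                      pdy H z / ((pdx H z) ^ 2 + (pdy H z) ^ 2)))
    (hμH : ∀ z, μH z =
      ((pdy (pdy H) z - pdx (pdx H) z) * (pdx H z) ^ 2
        - 4 * pdy (pdx H) z * pdx H z * pdy H z
        + (pdx (pdx H) z - pdy (pdy H) z) * (pdy H z) ^ 2)
      / ((pdx H z) ^ 2 + (pdy H z) ^ 2) ^ 2) :
    ∀ z ∈ Ω,
      (fderiv ℝ W z (V z) - fderiv ℝ V z (W z) = μH z • V z)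
      ∧ fderiv ℝ H z (W z) = 1 := by
  intro z hz
  have h2 : ContDiffAt ℝ 2 H z :=
    (hH.contDiffAt (hΩ.mem_nhds hz)).of_le (WithTop.coe_le_coe.2 le_top)
  have hX : HasFDerivAt (pdx H) (fderiv ℝ (pdx H) z) z :=
    (h2.differentiableAt_fderiv_apply (1, 0)).hasFDerivAt
  have hY : HasFDerivAt (pdy H) (fderiv ℝ (pdy H) z) z :=
    (h2.differentiableAt_fderiv_apply (0, 1)).hasFDerivAt
  have hr : (pdx H z) ^ 2 + (pdy H z) ^ 2 ≠ 0 := by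
    intro h0
    refine hgrad z hz (Prod.ext ?_ ?_) <;> simp only <;>
      nlinarith [sq_nonneg (pdx H z), sq_nonneg (pdy H z)]
  have hI := (hasDerivAt_inv hr).comp_hasFDerivAt z ((hX.pow 2).add (hY.pow 2))
  have hV' := hY.prodMk hX.neg
  have hW' := (hX.mul hI).prodMk (hY.mul hI)
  have hVd := (hV'.congr_of_eventuallyEq (.of_forall hV)).fderiv
  have hWd := (hW'.congr_of_eventuallyEq (f₁ := W)
    (.of_forall fun w ↦ by simp [hW, div_eq_mul_inv])).fderiv
  have hXd (s t : ℝ) : fderiv ℝ (pdx H) z (s, t) =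
      s * pdx (pdx H) z + t * pdy (pdx H) z := clm_prod_apply_eq _ s t
  have hYd (s t : ℝ) : fderiv ℝ (pdy H) z (s, t) =
      s * pdy (pdx H) z + t * pdy (pdy H) z := by
    rw [← h2.pdx_pdy_eq]
    exact clm_prod_apply_eq _ s t
  constructor
  · rw [hVd, hWd, hV, hW, hμH]
    ext
    all_goals
      simp [hXd, hYd]
      field_simp
      ring
  · rw [hW, clm_prod_apply_eq]
    change _ * pdx H z + _ * pdy H z = 1
    field_simp
end

section
/- Let A ⊆ ℝ² be open, V, W : A → ℝ² be C¹ vector fields, and s, t : A → ℝ be C¹ functions satisfying ∂_V s = 0, ∂_V t = 1, ∂_W s = 1, ∂_W t = 0 on A. Define Λ : A → ℝ² by Λ(z) = (e^{s(z)} sin t(z), e^{s(z)} cos t(z)) = (Λ₁(z), Λ₂(z)). Then for every z ∈ A, DΛ(z)(V(z)) = (Λ₂(z), −Λ₁(z)) and DΛ(z)(W(z)) = (Λ₁(z), Λ₂(z)); i.e. Λ transforms the system z' = V(z) into the linear center u' = v, v' = −u, and the system z' = W(z) into the radial system u' = u, v' = v. -/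
/-- if `∂_V s = 0`, `∂_V t = 1`, `∂_W s = 1`, `∂_W t = 0`, then
`Λ(z) = (e^{s(z)} sin t(z), e^{s(z)} cos t(z))` transforms `z' = V(z)` into the
linear center `u' = v, v' = −u` and `z' = W(z)` into the radial system
`u' = u, v' = v`. -/
theorem linearization_of_commuting_pair
    (A : Set (ℝ × ℝ)) (hA : IsOpen A)
    (V W : ℝ × ℝ → ℝ × ℝ)
    (hV : ContDiffOn ℝ 1 V A) (hW : ContDiffOn ℝ 1 W A)
    (s t : ℝ × ℝ → ℝ)
    (hs : ContDiffOn ℝ 1 s A) (ht : ContDiffOn ℝ 1 t A)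
    (hVs : ∀ z ∈ A, fderiv ℝ s z (V z) = 0)
    (hVt : ∀ z ∈ A, fderiv ℝ t z (V z) = 1)
    (hWs : ∀ z ∈ A, fderiv ℝ s z (W z) = 1)
    (hWt : ∀ z ∈ A, fderiv ℝ t z (W z) = 0)
    (Λ : ℝ × ℝ → ℝ × ℝ)
    (hΛ : ∀ z, Λ z = (Real.exp (s z) * Real.sin (t z),
                      Real.exp (s z) * Real.cos (t z))) :
    ∀ z ∈ A,
      fderiv ℝ Λ z (V z) = ((Λ z).2, -(Λ z).1)
      ∧ fderiv ℝ Λ z (W z) = ((Λ z).1, (Λ z).2) := by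
  intro z hz
  have hds : HasFDerivAt s (fderiv ℝ s z) z :=
    ((hs.contDiffAt (hA.mem_nhds hz)).differentiableAt one_ne_zero).hasFDerivAt
  have hdt : HasFDerivAt t (fderiv ℝ t z) z :=
    ((ht.contDiffAt (hA.mem_nhds hz)).differentiableAt one_ne_zero).hasFDerivAt
  have hdΛ := (hds.exp.mul hdt.sin).prodMk (hds.exp.mul hdt.cos)
  have hfderiv := (hdΛ.congr_of_eventuallyEq (Filter.Eventually.of_forall hΛ)).fderiv
  rw [hfderiv, hΛ z]
  constructor
  · simp [hVs z hz, hVt z hz]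
  · simp [hWs z hz, hWt z hz, mul_comm]
end

section
/- Let I_G, I_F ⊆ ℝ be open intervals, G : I_G → ℝ and F : I_F → ℝ be C² functions, and let (x, y) ∈ I_G × I_F be a point with G'(x) ≠ 0 and F'(y) ≠ 0. Consider the Hamiltonian vector field V(x,y) = (F'(y), −G'(x)) and the vector field W_s(x,y) = (2G(x)/G'(x), 2F(y)/F'(y)). Then [V, W_s](x,y) = μ_s(x,y)·V(x,y), where μ_s(x,y) = (2G/G')'(x) + (2F/F')'(y) − 2; i.e. W_s is a normalizer of V with N-cofactor μ_s. -/
/-- A function of class `C²` at `a` has a differentiable derivative there. -/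
lemma ContDiffAt.differentiableAt_deriv_of_two {f : ℝ → ℝ} {a : ℝ} (hf : ContDiffAt ℝ 2 f a) :
    DifferentiableAt ℝ (deriv f) a := by
  have h : DifferentiableAt ℝ (fderiv ℝ f) a :=
    (hf.fderiv_right (m := 1) (by norm_num)).differentiableAt one_ne_zero
  exact h.clm_apply (differentiableAt_const 1)

/-- The derivative of `2 f / f'` in terms of `f`, `f'`, `f''`. -/
lemma hasDerivAt_two_mul_div_deriv {f : ℝ → ℝ} {a : ℝ} (hf : ContDiffAt ℝ 2 f a)
    (ha : deriv f a ≠ 0) :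
    HasDerivAt (fun u => 2 * f u / deriv f u)
      (2 - 2 * f a * deriv (deriv f) a / deriv f a ^ 2) a := by
  have h := ((hf.differentiableAt two_ne_zero).hasDerivAt.const_mul 2).fun_div
    hf.differentiableAt_deriv_of_two.hasDerivAt ha
  refine h.congr_deriv ?_
  field_simp

/-- for a separable Hamiltonian system `x' = F'(y), y' = −G'(x)`,
the field `W_s = (2G/G', 2F/F')` is a normalizer with N-cofactor
`μ_s = (2G/G')' + (2F/F')' − 2`. -/
theorem separable_normalizer
    (IG IF : Set ℝ) (hIGopen : IsOpen IG) (hIFopen : IsOpen IF)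
    (hIGconn : IG.OrdConnected) (hIFconn : IF.OrdConnected)
    (G F : ℝ → ℝ)
    (hG : ContDiffOn ℝ 2 G IG) (hF : ContDiffOn ℝ 2 F IF)
    (x y : ℝ) (hx : x ∈ IG) (hy : y ∈ IF)
    (hGx : deriv G x ≠ 0) (hFy : deriv F y ≠ 0)
    (V Ws : ℝ × ℝ → ℝ × ℝ)
    (hV : ∀ p : ℝ × ℝ, V p = (deriv F p.2, -deriv G p.1))
    (hWs : ∀ p : ℝ × ℝ,
      Ws p = (2 * G p.1 / deriv G p.1, 2 * F p.2 / deriv F p.2))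
    (μs : ℝ)
    (hμs : μs = deriv (fun u => 2 * G u / deriv G u) x
              + deriv (fun v => 2 * F v / deriv F v) y - 2) :
    fderiv ℝ Ws (x, y) (V (x, y)) - fderiv ℝ V (x, y) (Ws (x, y))
      = μs • V (x, y) := by
  have hGa := hG.contDiffAt (hIGopen.mem_nhds hx)
  have hFa := hF.contDiffAt (hIFopen.mem_nhds hy)
  have hA := hasDerivAt_two_mul_div_deriv hGa hGx
  have hB := hasDerivAt_two_mul_div_deriv hFa hFy
  have hG' := hGa.differentiableAt_deriv_of_two.hasDerivAt
  have hF' := hFa.differentiableAt_deriv_of_two.hasDerivAt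
  have fst : HasFDerivAt (fun p : ℝ × ℝ => p.1) (.fst ℝ ℝ ℝ) (x, y) := hasFDerivAt_fst
  have snd : HasFDerivAt (fun p : ℝ × ℝ => p.2) (.snd ℝ ℝ ℝ) (x, y) := hasFDerivAt_snd
  have hDV := ((hF'.comp_hasFDerivAt (x, y) snd).prodMk
    (hG'.comp_hasFDerivAt (x, y) fst).neg).congr_of_eventuallyEq (.of_forall hV)
  have hDW := ((hA.comp_hasFDerivAt (x, y) fst).prodMk
    (hB.comp_hasFDerivAt (x, y) snd)).congr_of_eventuallyEq (.of_forall hWs)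
  rw [hDV.fderiv, hDW.fderiv, hμs, hA.deriv, hB.deriv, hV, hWs]
  ext <;> simp <;> field_simp <;> ring
end

section
/- Let G and F be C³ real functions on open intervals and let (x,y) be a point with G'(x) ≠ 0 and F'(y) ≠ 0. Set Γ = 2G/G', Φ = 2F/F', μ_s(x,y) = Γ'(x) + Φ'(y) − 2, and μ_{s2}(x,y) = μ_s(x,y)² + Γ(x)·∂_x μ_s(x,y) + Φ(y)·∂_y μ_s(x,y) (the derivative of μ_s along the vector field W_s = (Γ(x), Φ(y)) added to μ_s²). Then μ_{s2}(x,y) = 4·[1 + 2·(G(x)G''(x)/G'(x)²)·(F(y)F''(y)/F'(y)²) + (3G(x)²G''(x)² − 3G(x)G'(x)²G''(x) − G(x)²G'(x)G'''(x))/G'(x)⁴ + (3F(y)²F''(y)² − 3F(y)F'(y)²F''(y) − F(y)²F'(y)F'''(y))/F'(y)⁴]. -/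
/-- `Γ = 2G/G'`. -/
noncomputable def Gam (G : ℝ → ℝ) : ℝ → ℝ := fun u => 2 * G u / deriv G u

/-- `μ_s(x,y) = Γ'(x) + Φ'(y) − 2` with `Γ = 2G/G'`, `Φ = 2F/F'`. -/
noncomputable def mus (G F : ℝ → ℝ) (u v : ℝ) : ℝ :=
  deriv (Gam G) u + deriv (Gam F) v - 2

/-- `μ_{s2} = μ_s² + ∂_{W_s} μ_s`, where `W_s = (Γ(x), Φ(y))`. -/
noncomputable def mus2 (G F : ℝ → ℝ) (x y : ℝ) : ℝ :=
  (mus G F x y) ^ 2 + Gam G x * deriv (fun u => mus G F u y) x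
    + Gam F y * deriv (fun v => mus G F x v) y

/-- Where `G` is `C²` and `G' ≠ 0`, one has `(2G/G')' = 2 - 2GG''/G'²`. -/
lemma deriv_Gam_of_contDiffAt {G : ℝ → ℝ} {x : ℝ} (hG : ContDiffAt ℝ 2 G x)
    (hx : deriv G x ≠ 0) :
    deriv (Gam G) x = 2 - 2 * G x * deriv (deriv G) x / (deriv G x) ^ 2 := by
  have h0 : HasDerivAt G (deriv G x) x := (hG.differentiableAt (by norm_num)).hasDerivAt
  have hG1 : ContDiffAt ℝ 1 (deriv G) x := hG.derivWithin (by norm_num)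
  have h1 : HasDerivAt (deriv G) (deriv (deriv G) x) x :=
    (hG1.differentiableAt (by norm_num)).hasDerivAt
  rw [show Gam G = fun u => 2 * G u / deriv G u from rfl,
    ((h0.const_mul 2).fun_div h1 hx).deriv]
  field_simp

/-- The second derivative of `2G/G'` at a point where `G` is `C³` and `G' ≠ 0`. -/
lemma hasDerivAt_deriv_Gam {G : ℝ → ℝ} {x : ℝ} (hG : ContDiffAt ℝ 3 G x)
    (hx : deriv G x ≠ 0) :
    HasDerivAt (deriv (Gam G))
      (4 * G x * (deriv (deriv G) x) ^ 2 / (deriv G x) ^ 3 - 2 * deriv (deriv G) x / deriv G x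
        - 2 * G x * deriv (deriv (deriv G)) x / (deriv G x) ^ 2) x := by
  have h0 : HasDerivAt G (deriv G x) x := (hG.differentiableAt (by norm_num)).hasDerivAt
  have hG1 : ContDiffAt ℝ 2 (deriv G) x := hG.derivWithin (by norm_num)
  have h1 : HasDerivAt (deriv G) (deriv (deriv G) x) x :=
    (hG1.differentiableAt (by norm_num)).hasDerivAt
  have hG2 : ContDiffAt ℝ 1 (deriv (deriv G)) x := hG1.derivWithin (by norm_num)
  have h2 : HasDerivAt (deriv (deriv G)) (deriv (deriv (deriv G)) x) x :=
    (hG2.differentiableAt (by norm_num)).hasDerivAt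
  have hev : deriv (Gam G) =ᶠ[nhds x]
      fun u => 2 - 2 * G u * deriv (deriv G) u / (deriv G u) ^ 2 := by
    filter_upwards [hG.eventually (by decide), hG1.continuousAt.eventually_ne hx] with u hu hu'
    exact deriv_Gam_of_contDiffAt (hu.of_le (by norm_num)) hu'
  refine HasDerivAt.congr_of_eventuallyEq ?_ hev
  convert (((h0.const_mul 2).fun_mul h2).fun_div (h1.fun_pow 2) (pow_ne_zero 2 hx)).const_sub 2
    using 1
  field_simp
  ring

/-- explicit formula for `μ_{s2} = μ_s² + ∂_{W_s} μ_s` for a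
separable Hamiltonian `H = G(x) + F(y)`. -/
theorem mus2_formula
    (IG IF : Set ℝ) (hIGopen : IsOpen IG) (hIFopen : IsOpen IF)
    (hIGconn : IG.OrdConnected) (hIFconn : IF.OrdConnected)
    (G F : ℝ → ℝ)
    (hG : ContDiffOn ℝ 3 G IG) (hF : ContDiffOn ℝ 3 F IF)
    (x y : ℝ) (hx : x ∈ IG) (hy : y ∈ IF)
    (hGx : deriv G x ≠ 0) (hFy : deriv F y ≠ 0) :
    mus2 G F x y =
      4 * (1
        + 2 * (G x * deriv (deriv G) x / (deriv G x) ^ 2)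
            * (F y * deriv (deriv F) y / (deriv F y) ^ 2)
        + (3 * (G x) ^ 2 * (deriv (deriv G) x) ^ 2
            - 3 * G x * (deriv G x) ^ 2 * deriv (deriv G) x
            - (G x) ^ 2 * deriv G x * deriv (deriv (deriv G)) x)
          / (deriv G x) ^ 4
        + (3 * (F y) ^ 2 * (deriv (deriv F) y) ^ 2
            - 3 * F y * (deriv F y) ^ 2 * deriv (deriv F) y
            - (F y) ^ 2 * deriv F y * deriv (deriv (deriv F)) y)
          / (deriv F y) ^ 4) := by
  have hGc : ContDiffAt ℝ 3 G x := hG.contDiffAt (hIGopen.mem_nhds hx)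
  have hFc : ContDiffAt ℝ 3 F y := hF.contDiffAt (hIFopen.mem_nhds hy)
  have hμx : deriv (fun u => mus G F u y) x = _ :=
    (((hasDerivAt_deriv_Gam hGc hGx).add_const (deriv (Gam F) y)).sub_const 2).deriv
  have hμy : deriv (fun v => mus G F x v) y = _ :=
    (((hasDerivAt_deriv_Gam hFc hFy).const_add (deriv (Gam G) x)).sub_const 2).deriv
  rw [mus2, hμx, hμy, mus, deriv_Gam_of_contDiffAt (hGc.of_le (by norm_num)) hGx,
    deriv_Gam_of_contDiffAt (hFc.of_le (by norm_num)) hFy, Gam, Gam]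
  field_simp
  ring
end

section
/- Let G be a C³ real function on an open interval and let x be a point with G'(x) ≠ 0. For F(y) = y²/2 (so F' = y, F'' = 1, F''' = 0) and any y ≠ 0, the quantity μ_{s2}(x,y) = μ_s(x,y)² + ∂_{W_s}μ_s(x,y), with μ_s = (2G/G')' + (2F/F')' − 2 and W_s = (2G/G', 2F/F'), satisfies μ_{s2}(x,y) = (G'(x)⁴ − 8G(x)G'(x)²G''(x) + 12G(x)²G''(x)² − 4G(x)²G'(x)G'''(x))/G'(x)⁴; in particular μ_{s2} depends only on x, and it is nonnegative if and only if G'⁴ − 8GG'²G'' + 12G²G''² − 4G²G'G''' ≥ 0 at x. -/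
/-- For `F(y) = y²/2` one has `2F/F' = y`. -/
lemma Gam_sq_div_two : Gam (fun v => v ^ 2 / 2) = fun v => v := by
  have hd : deriv (fun v : ℝ => v ^ 2 / 2) = fun v => v := by
    funext v
    simp
  funext v
  simp only [Gam, hd]
  rcases eq_or_ne v 0 with rfl | hv
  · simp
  · field_simp

lemma mus_sq_div_two (G : ℝ → ℝ) (u v : ℝ) :
    mus G (fun v => v ^ 2 / 2) u v = deriv (Gam G) u - 1 := by
  simp only [mus, Gam_sq_div_two, deriv_id'']
  ring

lemma deriv_Gam {G : ℝ → ℝ} {u : ℝ} (h0 : DifferentiableAt ℝ G u)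
    (h1 : DifferentiableAt ℝ (deriv G) u) (hu : deriv G u ≠ 0) :
    deriv (Gam G) u = 2 - 2 * (G u * deriv (deriv G) u / deriv G u ^ 2) := by
  have h := ((h0.hasDerivAt.const_mul 2).div h1.hasDerivAt hu).deriv
  refine h.trans ?_
  field_simp

lemma ContDiffAt.deriv_of_le {f : ℝ → ℝ} {x : ℝ} {m n : WithTop ℕ∞}
    (hf : ContDiffAt ℝ n f x) (hmn : m + 1 ≤ n) : ContDiffAt ℝ m (deriv f) x :=
  (hf.fderiv_right hmn).clm_apply contDiffAt_const

lemma deriv_deriv_Gam {G : ℝ → ℝ} {x : ℝ} (hG : ContDiffAt ℝ 3 G x) (hx : deriv G x ≠ 0) :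
    deriv (deriv (Gam G)) x =
      -2 * (((deriv G x * deriv (deriv G) x + G x * deriv (deriv (deriv G)) x) * deriv G x ^ 2
        - G x * deriv (deriv G) x * (2 * deriv G x * deriv (deriv G) x))
          / (deriv G x ^ 2) ^ 2) := by
  have hG1 : ContDiffAt ℝ 2 (deriv G) x := hG.deriv_of_le (by norm_num)
  have hG2 : ContDiffAt ℝ 1 (deriv (deriv G)) x := hG1.deriv_of_le (by norm_num)
  have h0 := hG.differentiableAt (by norm_num)
  have h1 := hG1.differentiableAt (by norm_num)
  have h2 := hG2.differentiableAt (by norm_num)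
  have hev : deriv (Gam G) =ᶠ[nhds x]
      fun u => 2 - 2 * (G u * deriv (deriv G) u / deriv G u ^ 2) := by
    filter_upwards [hG.eventually (by simp), hG1.eventually (by simp),
      h1.continuousAt.eventually_ne hx] with u hu0 hu1 hu
    exact deriv_Gam (hu0.differentiableAt (by norm_num)) (hu1.differentiableAt (by norm_num)) hu
  rw [hev.deriv_eq]
  have h := ((((h0.hasDerivAt.mul h2.hasDerivAt).div (h1.hasDerivAt.pow 2)
    (pow_ne_zero 2 hx)).const_mul 2).const_sub 2).deriv
  refine h.trans ?_
  simp

/-- for a conservative second order equation, i.e.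
`F(y) = y²/2`, one has
`μ_{s2} = (G'⁴ − 8GG'²G'' + 12G²G''² − 4G²G'G''')/G'⁴`, an expression
depending only on `x`, which is nonnegative iff its numerator is. -/
theorem mus2_second_order_conservative
    (IG : Set ℝ) (hIGopen : IsOpen IG) (hIGconn : IG.OrdConnected)
    (G : ℝ → ℝ) (hG : ContDiffOn ℝ 3 G IG)
    (x : ℝ) (hx : x ∈ IG) (hGx : deriv G x ≠ 0)
    (y : ℝ) (hy : y ≠ 0) :
    mus2 G (fun v => v ^ 2 / 2) x y =
      ((deriv G x) ^ 4 - 8 * G x * (deriv G x) ^ 2 * deriv (deriv G) x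
        + 12 * (G x) ^ 2 * (deriv (deriv G) x) ^ 2
        - 4 * (G x) ^ 2 * deriv G x * deriv (deriv (deriv G)) x)
      / (deriv G x) ^ 4
    ∧
    (0 ≤ mus2 G (fun v => v ^ 2 / 2) x y ↔
      0 ≤ (deriv G x) ^ 4 - 8 * G x * (deriv G x) ^ 2 * deriv (deriv G) x
        + 12 * (G x) ^ 2 * (deriv (deriv G) x) ^ 2
        - 4 * (G x) ^ 2 * deriv G x * deriv (deriv (deriv G)) x) := by
  have hGat : ContDiffAt ℝ 3 G x := hG.contDiffAt (hIGopen.mem_nhds hx)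
  have hG1 : ContDiffAt ℝ 2 (deriv G) x := hGat.deriv_of_le (by norm_num)
  have key : mus2 G (fun v => v ^ 2 / 2) x y =
      ((deriv G x) ^ 4 - 8 * G x * (deriv G x) ^ 2 * deriv (deriv G) x
        + 12 * (G x) ^ 2 * (deriv (deriv G) x) ^ 2
        - 4 * (G x) ^ 2 * deriv G x * deriv (deriv (deriv G)) x)
      / (deriv G x) ^ 4 := by
    simp only [mus2, mus_sq_div_two, deriv_const, deriv_sub_const]
    rw [deriv_deriv_Gam hGat hGx, deriv_Gam (hGat.differentiableAt (by norm_num))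
      (hG1.differentiableAt (by norm_num)) hGx, Gam]
    field_simp
    ring
  have hpos : 0 < deriv G x ^ 4 := by positivity
  refine ⟨key, ?_⟩
  rw [key, le_div_iff₀ hpos, zero_mul]
end

section
/- Let G and F be C³ real functions on open intervals and let (x,y) be a point with G'(x) ≠ 0, F'(y) ≠ 0, G(x) ≥ 0 and F(y) ≥ 0. If 2G(x)G''(x)² − G'(x)²G''(x) − G(x)G'(x)G'''(x) ≥ 0 and 2F(y)F''(y)² − F'(y)²F''(y) − F(y)F'(y)F'''(y) ≥ 0 (condition (C)), then μ_{s2}(x,y) = μ_s(x,y)² + ∂_{W_s}μ_s(x,y) ≥ 0, where μ_s = (2G/G')' + (2F/F')' − 2 and W_s = (2G/G', 2F/F'). Indeed μ_{s2} = (Γ' + Φ' − 2)² + Γ''Γ + Φ''Φ with Γ = 2G/G', Φ = 2F/F', and condition (C) makes Γ''Γ ≥ 0 and Φ''Φ ≥ 0. -/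
/-- The product of `Γ` and its second derivative, in terms of the condition (C) expression of `G`,
at a point where `G` is `C³` with nonzero derivative. -/
theorem deriv_deriv_Gam_mul_Gam {I : Set ℝ} (hI : IsOpen I) {G : ℝ → ℝ}
    (hG : ContDiffOn ℝ 3 G I) {x : ℝ} (hx : x ∈ I) (hGx : deriv G x ≠ 0) :
    deriv (deriv (Gam G)) x * Gam G x =
      4 * G x * (2 * G x * (deriv (deriv G) x) ^ 2
        - (deriv G x) ^ 2 * deriv (deriv G) x
        - G x * deriv G x * deriv (deriv (deriv G)) x) / (deriv G x) ^ 4 := by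
  have h1 : ContDiffOn ℝ 2 (deriv G) I := hG.deriv_of_isOpen hI (by norm_num)
  have h2 : ContDiffOn ℝ 1 (deriv (deriv G)) I := h1.deriv_of_isOpen hI (by norm_num)
  have d0 : ∀ u ∈ I, HasDerivAt G (deriv G u) u := fun u hu =>
    ((hG.differentiableOn (by norm_num)).differentiableAt (hI.mem_nhds hu)).hasDerivAt
  have d1 : ∀ u ∈ I, HasDerivAt (deriv G) (deriv (deriv G) u) u := fun u hu =>
    ((h1.differentiableOn (by norm_num)).differentiableAt (hI.mem_nhds hu)).hasDerivAt
  have d2 : HasDerivAt (deriv (deriv G)) (deriv (deriv (deriv G)) x) x :=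
    ((h2.differentiableOn (by norm_num)).differentiableAt (hI.mem_nhds hx)).hasDerivAt
  have hev : deriv (Gam G) =ᶠ[nhds x]
      fun u => 2 - 2 * (G u * deriv (deriv G) u) / (deriv G u) ^ 2 := by
    filter_upwards [hI.mem_nhds hx, (d1 x hx).continuousAt.eventually_ne hGx] with u hu hne
    have h : HasDerivAt (Gam G) _ u := ((d0 u hu).const_mul 2).div (d1 u hu) hne
    rw [h.deriv]
    field_simp
  have h := ((((d0 x hx).mul d2).const_mul 2).div ((d1 x hx).pow 2)
    (pow_ne_zero 2 hGx)).const_sub 2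
  have hderiv : deriv (deriv (Gam G)) x = _ := hev.deriv_eq.trans h.deriv
  rw [hderiv]
  simp only [Gam, Pi.mul_apply, Pi.pow_apply]
  field_simp
  ring

/-- Where `G ≥ 0` satisfies condition (C), the product of `Γ` and its second derivative is
nonnegative. -/
theorem deriv_deriv_Gam_mul_Gam_nonneg {I : Set ℝ} (hI : IsOpen I) {G : ℝ → ℝ}
    (hG : ContDiffOn ℝ 3 G I) {x : ℝ} (hx : x ∈ I) (hGx : deriv G x ≠ 0) (hnn : 0 ≤ G x)
    (hC : 0 ≤ 2 * G x * (deriv (deriv G) x) ^ 2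
        - (deriv G x) ^ 2 * deriv (deriv G) x
        - G x * deriv G x * deriv (deriv (deriv G)) x) :
    0 ≤ deriv (deriv (Gam G)) x * Gam G x := by
  rw [deriv_deriv_Gam_mul_Gam hI hG hx hGx]
  exact div_nonneg (mul_nonneg (by linarith) hC) (by positivity)

/-- if `G, F ≥ 0` satisfy condition (C)
(`2LL''² − L'²L'' − LL'L''' ≥ 0`) at the point, then
`μ_{s2} = (Γ' + Φ' − 2)² + Γ''Γ + Φ''Φ ≥ 0`. -/
theorem mus2_nonneg_of_condition_C
    (IG IF : Set ℝ) (hIGopen : IsOpen IG) (hIFopen : IsOpen IF)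
    (hIGconn : IG.OrdConnected) (hIFconn : IF.OrdConnected)
    (G F : ℝ → ℝ)
    (hG : ContDiffOn ℝ 3 G IG) (hF : ContDiffOn ℝ 3 F IF)
    (x y : ℝ) (hx : x ∈ IG) (hy : y ∈ IF)
    (hGx : deriv G x ≠ 0) (hFy : deriv F y ≠ 0)
    (hGnn : 0 ≤ G x) (hFnn : 0 ≤ F y)
    (hCG : 0 ≤ 2 * G x * (deriv (deriv G) x) ^ 2
        - (deriv G x) ^ 2 * deriv (deriv G) x
        - G x * deriv G x * deriv (deriv (deriv G)) x)
    (hCF : 0 ≤ 2 * F y * (deriv (deriv F) y) ^ 2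
        - (deriv F y) ^ 2 * deriv (deriv F) y
        - F y * deriv F y * deriv (deriv (deriv F)) y) :
    mus2 G F x y =
      (deriv (Gam G) x + deriv (Gam F) y - 2) ^ 2
        + deriv (deriv (Gam G)) x * Gam G x
        + deriv (deriv (Gam F)) y * Gam F y
    ∧ 0 ≤ mus2 G F x y := by
  have heq : mus2 G F x y =
      (deriv (Gam G) x + deriv (Gam F) y - 2) ^ 2
        + deriv (deriv (Gam G)) x * Gam G x
        + deriv (deriv (Gam F)) y * Gam F y := by
    simp only [mus2, mus, deriv_sub_const, deriv_add_const, deriv_const_add]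
    ring
  refine ⟨heq, ?_⟩
  have h1 := deriv_deriv_Gam_mul_Gam_nonneg hIGopen hG hx hGx hGnn hCG
  have h2 := deriv_deriv_Gam_mul_Gam_nonneg hIFopen hF hy hFy hFnn hCF
  rw [heq]
  positivity
end

section
/- Let k, n be positive reals with n² − 6nk + k² ≤ 0 (equivalently (3 − 2√2)n ≤ k ≤ (3 + 2√2)n). Let ξ_k, ξ_n : Ω → ℝ be C² functions on an open set Ω ⊆ ℝ² satisfying the Euler identities x·∂_x ξ_k + y·∂_y ξ_k = k·ξ_k and x·∂_x ξ_n + y·∂_y ξ_n = n·ξ_n on Ω (as holds for homogeneous functions of degrees k and n). Set ξ = ξ_k − ξ_n and, for the radial field W(x,y) = (x,y), write ξ' = ∂_W ξ and ξ'' = ∂_W ξ'. Then at every point of Ω, 2ξ'² − ξ''·ξ = k²ξ_k² + (k² + n² − 4kn)ξ_kξ_n + n²ξ_n² ≥ 0. -/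
/-- A quadratic form `k²a² + (k² + n² − 4kn)ab + n²b²` with `n² − 6nk + k² ≤ 0` is nonnegative. -/
lemma quadratic_form_nonneg (k n a b : ℝ) (hdisc : n ^ 2 - 6 * n * k + k ^ 2 ≤ 0) :
    0 ≤ k ^ 2 * a ^ 2 + (k ^ 2 + n ^ 2 - 4 * k * n) * a * b + n ^ 2 * b ^ 2 := by
  rcases le_total 0 (a * b) with hab | hab
  · nlinarith [sq_nonneg (k * a - n * b), mul_nonneg hab (sq_nonneg (k - n))]
  · nlinarith [sq_nonneg (k * a + n * b), mul_nonneg_of_nonpos_of_nonpos hab hdisc]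

/-- Linear combinations of functions satisfying Euler's identity, differentiated along the
radial field. -/
lemma fderiv_apply_self_of_eqOn_linear_combination
    {E : Type*} [NormedAddCommGroup E] [NormedSpace ℝ E]
    {k n c d : ℝ} {Ω : Set E} (hΩ : IsOpen Ω) {f g h : E → ℝ}
    (hf : DifferentiableOn ℝ f Ω) (hg : DifferentiableOn ℝ g Ω)
    (hEulerf : ∀ z ∈ Ω, fderiv ℝ f z z = k * f z)
    (hEulerg : ∀ z ∈ Ω, fderiv ℝ g z z = n * g z)
    (hh : ∀ z ∈ Ω, h z = c * f z - d * g z) {z : E} (hz : z ∈ Ω) :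
    fderiv ℝ h z z = c * k * f z - d * n * g z := by
  have hzΩ := hΩ.mem_nhds hz
  have hloc : h =ᶠ[nhds z] fun w => c * f w - d * g w := by
    filter_upwards [hzΩ] with w hw using hh w hw
  have hderiv := (((hf.differentiableAt hzΩ).hasFDerivAt.const_mul c).sub
    ((hg.differentiableAt hzΩ).hasFDerivAt.const_mul d)).congr_of_eventuallyEq hloc
  rw [hderiv.fderiv]
  simp [hEulerf z hz, hEulerg z hz, mul_assoc]

/-- for `ξ = ξ_k − ξ_n` with `ξ_k, ξ_n` satisfying the Euler
identities of homogeneous functions of degrees `k, n` (with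
`n² − 6nk + k² ≤ 0`), and `ξ' = ∂_W ξ`, `ξ'' = ∂_W ξ'` along the radial field
`W(x,y) = (x,y)`, one has
`2ξ'² − ξ''ξ = k²ξ_k² + (k² + n² − 4kn)ξ_kξ_n + n²ξ_n² ≥ 0`. -/
theorem radial_homogeneous_quadratic_form
    (k n : ℝ) (hk : 0 < k) (hn : 0 < n)
    (hdisc : n ^ 2 - 6 * n * k + k ^ 2 ≤ 0)
    (Ω : Set (ℝ × ℝ)) (hΩ : IsOpen Ω)
    (ξk ξn : ℝ × ℝ → ℝ)
    (hξk : ContDiffOn ℝ 2 ξk Ω) (hξn : ContDiffOn ℝ 2 ξn Ω)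
    (hEulerk : ∀ z ∈ Ω, fderiv ℝ ξk z z = k * ξk z)
    (hEulern : ∀ z ∈ Ω, fderiv ℝ ξn z z = n * ξn z)
    (ξ : ℝ × ℝ → ℝ) (hξ : ∀ z, ξ z = ξk z - ξn z)
    (ξ' : ℝ × ℝ → ℝ) (hξ' : ∀ z, ξ' z = fderiv ℝ ξ z z)
    (ξ'' : ℝ × ℝ → ℝ) (hξ'' : ∀ z, ξ'' z = fderiv ℝ ξ' z z) :
    ∀ z ∈ Ω,
      2 * (ξ' z) ^ 2 - ξ'' z * ξ z =
        k ^ 2 * (ξk z) ^ 2 + (k ^ 2 + n ^ 2 - 4 * k * n) * ξk z * ξn z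
          + n ^ 2 * (ξn z) ^ 2
      ∧ 0 ≤ 2 * (ξ' z) ^ 2 - ξ'' z * ξ z := by
  have hdk : DifferentiableOn ℝ ξk Ω := hξk.differentiableOn (by norm_num)
  have hdn : DifferentiableOn ℝ ξn Ω := hξn.differentiableOn (by norm_num)
  have hfirst : ∀ z ∈ Ω, ξ' z = k * ξk z - n * ξn z := fun z hz => by
    rw [hξ', fderiv_apply_self_of_eqOn_linear_combination (c := 1) (d := 1) hΩ hdk hdn
      hEulerk hEulern (fun w _ => by rw [hξ, one_mul, one_mul]) hz, one_mul, one_mul]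
  intro z hz
  have hsecond : ξ'' z = k * k * ξk z - n * n * ξn z := by
    rw [hξ'', fderiv_apply_self_of_eqOn_linear_combination hΩ hdk hdn
      hEulerk hEulern hfirst hz]
  have hform : 2 * (ξ' z) ^ 2 - ξ'' z * ξ z =
      k ^ 2 * (ξk z) ^ 2 + (k ^ 2 + n ^ 2 - 4 * k * n) * ξk z * ξn z
        + n ^ 2 * (ξn z) ^ 2 := by
    rw [hfirst z hz, hsecond, hξ]
    ring
  exact ⟨hform, hform ▸ quadratic_form_nonneg k n (ξk z) (ξn z) hdisc⟩
end

section
/- Let a, b, c be positive reals with 5b² ≤ 56ac, and define L : ℝ → ℝ by L(t) = 1/(a + bt⁴ + ct⁸). Then for every t ∈ ℝ, ζ(t) = 2L(t)L''(t)² − L'(t)²L''(t) − L(t)L'(t)L'''(t) ≥ 0; indeed ζ(t) = 64t⁴·(6bc²t¹² + (56ac² − 5b²c)t⁸ + 18abct⁴ + 3ab²)/(a + bt⁴ + ct⁸)⁶. -/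
/-- The quantity of condition (C) for a reciprocal `L = 1 / D`, where `p`, `q`, `r` are the first
three derivatives of `D`. -/
theorem condition_C_expr_one_div {L D p q r : ℝ → ℝ} (hL : ∀ t, L t = 1 / D t)
    (h0 : ∀ t, D t ≠ 0) (hD : ∀ t, HasDerivAt D (p t) t)
    (hp : ∀ t, HasDerivAt p (q t) t) (hq : ∀ t, HasDerivAt q (r t) t) (t : ℝ) :
    2 * L t * (deriv (deriv L) t) ^ 2 - (deriv L t) ^ 2 * deriv (deriv L) t
        - L t * deriv L t * deriv (deriv (deriv L)) t
      = (D t * (2 * q t ^ 2 - p t * r t) - p t ^ 2 * q t) / D t ^ 6 := by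
  have h1 : deriv L = fun t => -p t / D t ^ 2 := by
    have hL' : L = fun t => (D t)⁻¹ := by
      funext s
      rw [hL, one_div]
    funext s
    rw [hL']
    exact ((hD s).fun_inv (h0 s)).deriv
  have h2 : deriv (deriv L) = fun t => (2 * p t ^ 2 - D t * q t) / D t ^ 3 := by
    funext s
    rw [h1, ((hp s).fun_neg.fun_div ((hD s).fun_pow 2) (pow_ne_zero 2 (h0 s))).deriv]
    have := h0 s
    field_simp
    ring
  have h3 : deriv (deriv (deriv L)) t =
      (6 * D t * p t * q t - 6 * p t ^ 3 - D t ^ 2 * r t) / D t ^ 4 := by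
    have hnum := (((hp t).fun_pow 2).const_mul 2).fun_sub ((hD t).fun_mul (hq t))
    rw [h2, (hnum.fun_div ((hD t).fun_pow 3) (pow_ne_zero 3 (h0 t))).deriv]
    have := h0 t
    field_simp
    ring
  rw [h3, h2, h1, hL]
  have := h0 t
  field_simp
  ring

/-- the function `L(t) = 1/(a + bt⁴ + ct⁸)` with `a, b, c > 0`
and `5b² ≤ 56ac` satisfies condition (C) at every point:
`ζ = 2LL''² − L'²L'' − LL'L''' ≥ 0`, with the explicit formula
`ζ(t) = 64t⁴(6bc²t¹² + (56ac² − 5b²c)t⁸ + 18abct⁴ + 3ab²)/(a + bt⁴ + ct⁸)⁶`. -/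
theorem condition_C_for_rational_potential
    (a b c : ℝ) (ha : 0 < a) (hb : 0 < b) (hc : 0 < c)
    (habc : 5 * b ^ 2 ≤ 56 * a * c)
    (L : ℝ → ℝ) (hL : ∀ t, L t = 1 / (a + b * t ^ 4 + c * t ^ 8))
    (ζ : ℝ → ℝ)
    (hζ : ∀ t, ζ t = 2 * L t * (deriv (deriv L) t) ^ 2
        - (deriv L t) ^ 2 * deriv (deriv L) t
        - L t * deriv L t * deriv (deriv (deriv L)) t) :
    ∀ t : ℝ,
      ζ t = 64 * t ^ 4 *
          (6 * b * c ^ 2 * t ^ 12 + (56 * a * c ^ 2 - 5 * b ^ 2 * c) * t ^ 8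
            + 18 * a * b * c * t ^ 4 + 3 * a * b ^ 2)
          / (a + b * t ^ 4 + c * t ^ 8) ^ 6
      ∧ 0 ≤ ζ t := by
  intro t
  have hpos : ∀ s : ℝ, 0 < a + b * s ^ 4 + c * s ^ 8 := fun s => by positivity
  have hD (s : ℝ) : HasDerivAt (fun s => a + b * s ^ 4 + c * s ^ 8)
      (4 * b * s ^ 3 + 8 * c * s ^ 7) s := by
    refine ((((hasDerivAt_pow 4 s).const_mul b).const_add a).fun_add
      ((hasDerivAt_pow 8 s).const_mul c)).congr_deriv ?_
    push_cast
    ring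
  have hp (s : ℝ) : HasDerivAt (fun s => 4 * b * s ^ 3 + 8 * c * s ^ 7)
      (12 * b * s ^ 2 + 56 * c * s ^ 6) s := by
    refine (((hasDerivAt_pow 3 s).const_mul (4 * b)).fun_add
      ((hasDerivAt_pow 7 s).const_mul (8 * c))).congr_deriv ?_
    push_cast
    ring
  have hq (s : ℝ) : HasDerivAt (fun s => 12 * b * s ^ 2 + 56 * c * s ^ 6)
      (24 * b * s + 336 * c * s ^ 5) s := by
    refine (((hasDerivAt_pow 2 s).const_mul (12 * b)).fun_add
      ((hasDerivAt_pow 6 s).const_mul (56 * c))).congr_deriv ?_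
    push_cast
    ring
  have hform : ζ t = 64 * t ^ 4 *
      (6 * b * c ^ 2 * t ^ 12 + (56 * a * c ^ 2 - 5 * b ^ 2 * c) * t ^ 8
        + 18 * a * b * c * t ^ 4 + 3 * a * b ^ 2)
      / (a + b * t ^ 4 + c * t ^ 8) ^ 6 := by
    rw [hζ, condition_C_expr_one_div hL (fun s => (hpos s).ne') hD hp hq]
    congr 1
    ring
  refine ⟨hform, ?_⟩
  have hcoef : 0 ≤ 56 * a * c ^ 2 - 5 * b ^ 2 * c := by
    have := mul_nonneg hc.le (sub_nonneg.2 habc)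
    linarith
  have hden := hpos t
  rw [hform]
  positivity
end
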